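/- arXiv:1106.0111 — 5 statements merged into one kernel-verified Lean document; each statement's English description precedes it below -/
import Mathlib

section
/- Let n ≥ 2, let a < b be real numbers, and let p : ℝ → ℝ be a polynomial function of degree at most n−1. Define the cropped function Cr_{[a,b]} p : ℝ → ℝ by (Cr_{[a,b]} p)(x) = p(x) for x ∈ [a,b], = p(b) for x ≥ b, and = p(a) for x ≤ a. Then the topological entropy of Cr_{[a,b]} p satisfies h_top(Cr_{[a,b]} p) ≤ log(n−1). In particular, the lower bound log(n−1) of Theorem B is sharp. -/
open BoundedContinuousFunction

/-- The topological entropy of `f : ℝ → ℝ`, defined as the (Bowen/cover) topological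
entropy of `f` on the closure of its image. -/
noncomputable def htop (f : ℝ → ℝ) : EReal :=
  Dynamics.coverEntropy f (closure (Set.range f))

/-- `f` has a `d`-horseshoe: there are `d` nondegenerate compact intervals with pairwise
disjoint interiors, each of whose images under `f` contains all of them. -/
def HasHorseshoe (f : ℝ → ℝ) (d : ℕ) : Prop :=
  ∃ I : Fin d → ℝ × ℝ,
    (∀ i, (I i).1 < (I i).2) ∧
    (∀ i j, i ≠ j →
      Disjoint (interior (Set.Icc (I i).1 (I i).2)) (interior (Set.Icc (I j).1 (I j).2))) ∧
    (∀ i j, Set.Icc (I j).1 (I j).2 ⊆ f '' Set.Icc (I i).1 (I i).2)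

open MeasureTheory in
/-- If almost every fibre of a continuous function `g` has at most `M` points, then the variation
of `g` along a strictly increasing sequence is at most `M` times the length of an interval
containing the values of `g` on that sequence. -/
theorem sum_abs_sub_le_of_card_fiber_le {g : ℝ → ℝ} (hg : Continuous g) {B : Set ℝ}
    (hB : B.Countable) {M : ℕ}
    (hM : ∀ y ∉ B, ∃ s : Finset ℝ, s.card ≤ M ∧ ∀ x, g x = y → x ∈ s)
    {c e : ℝ} (hce : c ≤ e) {m : ℕ} {x : Fin (m + 1) → ℝ} (hx : StrictMono x)
    (hgx : ∀ i, g (x i) ∈ Set.Icc c e) :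
    ∑ i : Fin m, |g (x i.succ) - g (x i.castSucc)| ≤ M * (e - c) := by
  classical
  let I : Fin m → Set ℝ := fun i => Set.uIcc (g (x i.castSucc)) (g (x i.succ))
  have hIsub : ∀ i, I i ⊆ Set.Icc c e := fun i => Set.uIcc_subset_Icc (hgx _) (hgx _)
  have hae : ∀ᵐ y ∂volume, ∑ i, (I i).indicator (1 : ℝ → ENNReal) y ≤
      (Set.Icc c e).indicator (fun _ => (M : ENNReal)) y := by
    have hnull : ∀ᵐ y ∂(volume : Measure ℝ), y ∉ B ∪ Set.range (g ∘ x) :=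
      (hB.union (Set.countable_range _)).ae_notMem _
    filter_upwards [hnull] with y hy
    rw [Set.mem_union, not_or] at hy
    obtain ⟨hyB, hyx⟩ := hy
    have hyx' : ∀ i, g (x i) ≠ y := fun i hi => hyx ⟨i, hi⟩
    by_cases hyc : y ∈ Set.Icc c e
    · rw [Set.indicator_of_mem hyc]
      obtain ⟨s, hs, hsy⟩ := hM y hyB
      have hsum : ∑ i, (I i).indicator (1 : ℝ → ENNReal) y =
          ((Finset.univ.filter fun i => y ∈ I i).card : ENNReal) := by
        simp [Set.indicator_apply, Finset.sum_boole]
      rw [hsum]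
      have hz : ∀ i, y ∈ I i → ∃ z ∈ Set.Ioo (x i.castSucc) (x i.succ), g z = y := by
        intro i hi
        have hlt : x i.castSucc < x i.succ := hx i.castSucc_lt_succ
        obtain ⟨z, hz, hzy⟩ := intermediate_value_uIcc hg.continuousOn hi
        rw [Set.uIcc_of_le hlt.le] at hz
        refine ⟨z, ⟨lt_of_le_of_ne hz.1 ?_, lt_of_le_of_ne hz.2 ?_⟩, hzy⟩
        · rintro rfl
          exact hyx' _ hzy
        · rintro rfl
          exact hyx' _ hzy
      choose! z hz hzy using hz
      have hord : ∀ i j, y ∈ I i → y ∈ I j → i < j → z i < z j := by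
        intro i j hi hj hij
        have h1 := (hz i hi).2
        have h2 := (hz j hj).1
        have h3 : x i.succ ≤ x j.castSucc :=
          hx.monotone (by rw [Fin.le_def]; simpa using hij)
        linarith
      have hcard : (Finset.univ.filter fun i => y ∈ I i).card ≤ s.card := by
        refine Finset.card_le_card_of_injOn z ?_ ?_
        · intro i hi
          exact hsy _ (hzy i (by simpa using hi))
        · intro i hi j hj hij
          have hi' : y ∈ I i := by simpa using hi
          have hj' : y ∈ I j := by simpa using hj
          rcases lt_trichotomy i j with h | h | h
          · exact absurd hij (hord i j hi' hj' h).ne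
          · exact h
          · exact absurd hij (hord j i hj' hi' h).ne'
      exact_mod_cast hcard.trans hs
    · rw [Set.indicator_of_notMem hyc]
      refine (Finset.sum_eq_zero fun i _ => ?_).le
      exact Set.indicator_of_notMem (fun h => hyc (hIsub i h)) _
  have hint := lintegral_mono_ae hae
  have hmeas : ∀ i, MeasurableSet (I i) := fun i => measurableSet_uIcc
  rw [lintegral_finsetSum _ fun i _ => measurable_one.indicator (hmeas i)] at hint
  simp only [lintegral_indicator_one (hmeas _), lintegral_indicator measurableSet_Icc,
    setLIntegral_const, Real.volume_Icc, I, Real.volume_interval] at hint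
  rw [← ENNReal.ofReal_sum_of_nonneg fun i _ => abs_nonneg _, ← ENNReal.ofReal_natCast,
    ← ENNReal.ofReal_mul (Nat.cast_nonneg _)] at hint
  exact (ENNReal.ofReal_le_ofReal_iff
    (mul_nonneg (Nat.cast_nonneg _) (sub_nonneg.2 hce))).1 hint

/-- If the fibres of `f` outside `B` have at most `d` points, then the fibres of `f^[k]` outside
the forward orbit of `B` have at most `d ^ k` points. -/
theorem exists_finset_fiber_iterate {X : Type*} {f : X → X} {B : Set X} {d : ℕ}
    (hd : ∀ y ∉ B, ∃ s : Finset X, s.card ≤ d ∧ ∀ x, f x = y → x ∈ s) (k : ℕ) {y : X}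
    (hy : y ∉ ⋃ j, f^[j] '' B) :
    ∃ s : Finset X, s.card ≤ d ^ k ∧ ∀ x, f^[k] x = y → x ∈ s := by
  classical
  induction k with
  | zero => exact ⟨{y}, by simp, by simp⟩
  | succ k ih =>
    obtain ⟨s, hs, hsy⟩ := ih
    have hz : ∀ z, f^[k] z = y → ∃ t : Finset X, t.card ≤ d ∧ ∀ x, f x = z → x ∈ t :=
      fun z hz => hd z fun hzB => hy (Set.mem_iUnion.2 ⟨k, z, hzB, hz⟩)
    choose! t ht htz using hz
    refine ⟨(s.filter fun z => f^[k] z = y).biUnion t, ?_, ?_⟩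
    · calc _ ≤ (s.filter fun z => f^[k] z = y).card * d :=
            Finset.card_biUnion_le_card_mul _ _ _ fun z hz => ht z (Finset.mem_filter.1 hz).2
        _ ≤ d ^ k * d := Nat.mul_le_mul_right _ ((Finset.card_filter_le _ _).trans hs)
        _ = d ^ (k + 1) := (pow_succ _ _).symm
    · intro x hx
      rw [Function.iterate_succ_apply] at hx
      exact Finset.mem_biUnion.2 ⟨f x, Finset.mem_filter.2 ⟨hsy _ hx, hx⟩, htz _ hx x rfl⟩

/-- A `(k, ε)`-separated subset of an invariant interval `[c, e]` has cardinality
`O(k * d ^ k)` if all but countably many fibres of `f` have at most `d` points. -/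
theorem Dynamics.IsDynNetIn.card_le_of_card_fiber_le {f : ℝ → ℝ} (hf : Continuous f) {B : Set ℝ}
    (hB : B.Countable) {d : ℕ} (hd0 : 1 ≤ d)
    (hd : ∀ y ∉ B, ∃ s : Finset ℝ, s.card ≤ d ∧ ∀ x, f x = y → x ∈ s)
    {c e : ℝ} (hce : c ≤ e) (hmaps : Set.MapsTo f (Set.Icc c e) (Set.Icc c e))
    {F : Set ℝ} (hF : F ⊆ Set.Icc c e) {ε : ℝ} (hε : 0 < ε) {k : ℕ} {S : Finset ℝ}
    (hS : Dynamics.IsDynNetIn f F {q : ℝ × ℝ | dist q.1 q.2 < ε} k S) :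
    (S.card : ℝ) ≤ 1 + k * d ^ k * (e - c) / ε := by
  have hce' : 0 ≤ e - c := sub_nonneg.2 hce
  rcases hm : S.card with _ | m
  · simp only [Nat.cast_zero]
    positivity
  let x := S.orderEmbOfFin hm
  have hxS : ∀ i, x i ∈ S := fun i => S.orderEmbOfFin_mem hm i
  have hx : StrictMono x := x.strictMono
  have hsep : ∀ i : Fin m, ε ≤
      ∑ j ∈ Finset.range k, |f^[j] (x i.succ) - f^[j] (x i.castSucc)| := by
    intro i
    by_contra! hlt
    have hne : x i.castSucc ≠ x i.succ := (hx i.castSucc_lt_succ).ne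
    have hdisj := hS.2 (hxS i.castSucc) (hxS i.succ) hne
    refine Set.disjoint_left.1 hdisj (?_ : x i.succ ∈ _) ?_
    · refine Dynamics.mem_ball_dynEntourage.2 ?_
      intro j hj
      change dist _ _ < ε
      rw [dist_comm, Real.dist_eq]
      refine lt_of_le_of_lt ?_ hlt
      exact Finset.single_le_sum
        (f := fun j => |f^[j] (x i.succ) - f^[j] (x i.castSucc)|)
        (fun j _ => abs_nonneg _) (Finset.mem_range.2 hj)
    · refine Dynamics.mem_ball_dynEntourage.2 ?_
      intro j hj
      change dist _ _ < ε
      rwa [dist_self]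
  have hvar : ∀ j ∈ Finset.range k,
      ∑ i : Fin m, |f^[j] (x i.succ) - f^[j] (x i.castSucc)| ≤ d ^ k * (e - c) := by
    intro j hj
    have hBj : (⋃ j, f^[j] '' B).Countable := Set.countable_iUnion fun j => hB.image _
    have := sum_abs_sub_le_of_card_fiber_le (hf.iterate j) hBj
      (fun y hy => exists_finset_fiber_iterate hd j hy) hce hx
      (fun i => hmaps.iterate j (hF (hS.1 (hxS i))))
    refine this.trans (mul_le_mul_of_nonneg_right ?_ hce')
    push_cast
    exact pow_le_pow_right₀ (by exact_mod_cast hd0) (Finset.mem_range.1 hj).le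
  have key : (m : ℝ) * ε ≤ k * d ^ k * (e - c) := by
    calc (m : ℝ) * ε = ∑ _i : Fin m, ε := by simp
      _ ≤ ∑ i : Fin m, ∑ j ∈ Finset.range k, |f^[j] (x i.succ) - f^[j] (x i.castSucc)| :=
        Finset.sum_le_sum fun i _ => hsep i
      _ = ∑ j ∈ Finset.range k, ∑ i : Fin m, |f^[j] (x i.succ) - f^[j] (x i.castSucc)| :=
        Finset.sum_comm
      _ ≤ ∑ _j ∈ Finset.range k, (d : ℝ) ^ k * (e - c) := Finset.sum_le_sum hvar
      _ = k * d ^ k * (e - c) := by simp [mul_assoc]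
  have := (le_div_iff₀ hε).2 key
  push_cast
  linarith

/-- A continuous map of a compact interval, all but countably many of whose fibres have at most
`d` points, has entropy at most `log d`. -/
theorem coverEntropy_le_log_of_card_fiber_le {f : ℝ → ℝ} (hf : Continuous f) {B : Set ℝ}
    (hB : B.Countable) {d : ℕ} (hd0 : 1 ≤ d)
    (hd : ∀ y ∉ B, ∃ s : Finset ℝ, s.card ≤ d ∧ ∀ x, f x = y → x ∈ s)
    {c e : ℝ} (hce : c ≤ e) (hmaps : Set.MapsTo f (Set.Icc c e) (Set.Icc c e))
    {F : Set ℝ} (hF : F ⊆ Set.Icc c e) :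
    Dynamics.coverEntropy f F ≤ (Real.log d : EReal) := by
  rw [Dynamics.coverEntropy_eq_iSup_basis_netEntropyEntourage Metric.uniformity_basis_dist]
  refine iSup₂_le fun ε hε => ?_
  rw [← EReal.le_of_forall_lt_iff_le]
  intro z hz
  have hdpos : (0 : ℝ) < d := by exact_mod_cast hd0
  have hz' : (d : ℝ) < Real.exp z := by
    rw [← Real.log_lt_iff_lt_exp hdpos]
    exact_mod_cast hz
  have hz1 : 1 ≤ Real.exp z := (Nat.one_le_cast.2 hd0).trans hz'.le
  have hce' : 0 ≤ e - c := sub_nonneg.2 hce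
  have hlim : ∀ᶠ k : ℕ in Filter.atTop, (k : ℝ) * d ^ k ≤ Real.exp z ^ k := by
    have h := tendsto_self_mul_const_pow_of_lt_one (r := d / Real.exp z) (by positivity)
      ((div_lt_one (Real.exp_pos z)).2 hz')
    filter_upwards [h.eventually (eventually_le_nhds zero_lt_one)] with k hk
    rwa [div_pow, ← mul_div_assoc, div_le_one (by positivity)] at hk
  rw [← ExpGrowth.expGrowthSup_exp (a := (z : EReal))]
  refine ExpGrowth.expGrowthSup_le_of_eventually_le
    (b := ENNReal.ofReal (1 + (e - c) / ε)) ENNReal.ofReal_ne_top ?_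
  filter_upwards [hlim] with k hk
  have hexp : EReal.exp ((z : EReal) * (k : EReal)) = ENNReal.ofReal (Real.exp z ^ k) := by
    rw [← Real.exp_nat_mul, mul_comm (k : ℝ), ← EReal.exp_coe]
    push_cast
    rfl
  rw [hexp, ← ENNReal.ofReal_mul (by positivity)]
  have hcard : ∀ S : Finset ℝ,
      Dynamics.IsDynNetIn f F {q : ℝ × ℝ | dist q.1 q.2 < ε} k S →
      S.card ≤ ⌊(1 + (e - c) / ε) * Real.exp z ^ k⌋₊ := by
    intro S hS
    refine Nat.le_floor ((hS.card_le_of_card_fiber_le hf hB hd0 hd hce hmaps hF hε).trans ?_)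
    have h1 : 1 ≤ Real.exp z ^ k := one_le_pow₀ hz1
    have h2 : k * d ^ k * (e - c) / ε ≤ Real.exp z ^ k * (e - c) / ε := by gcongr
    calc _ ≤ Real.exp z ^ k + Real.exp z ^ k * (e - c) / ε := add_le_add h1 h2
      _ = _ := by ring
  have hnet : Dynamics.netMaxcard f F {q : ℝ × ℝ | dist q.1 q.2 < ε} k ≤
      (⌊(1 + (e - c) / ε) * Real.exp z ^ k⌋₊ : ℕ∞) :=
    iSup₂_le fun S hS => by exact_mod_cast hcard S hS
  refine (ENat.toENNReal_mono hnet).trans ?_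
  rw [ENat.toENNReal_coe, ← ENNReal.ofReal_natCast]
  exact ENNReal.ofReal_le_ofReal (Nat.floor_le (by positivity))

theorem cropped_polynomial_entropy_upper_bound (n : ℕ) (hn : 2 ≤ n)
    (a b : ℝ) (hab : a < b) (p : Polynomial ℝ) (hp : p.natDegree ≤ n - 1) :
    htop (fun x : ℝ =>
        if x ≤ a then p.eval a else if b ≤ x then p.eval b else p.eval x)
      ≤ (Real.log ((n : ℝ) - 1) : EReal) := by
  classical
  set f : ℝ → ℝ := fun x : ℝ =>
    if x ≤ a then p.eval a else if b ≤ x then p.eval b else p.eval x with hfdef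
  have hproj : f = fun x => p.eval (Set.projIcc a b hab.le x : ℝ) := by
    funext x
    simp only [hfdef]
    split_ifs with h1 h2
    · rw [Set.projIcc_of_le_left _ h1]
    · rw [Set.projIcc_of_right_le _ h2]
    · rw [Set.projIcc_of_mem hab.le ⟨(not_le.1 h1).le, (not_le.1 h2).le⟩]
  have hf : Continuous f := by
    rw [hproj]
    exact p.continuous.comp (continuous_subtype_val.comp continuous_projIcc)
  have hrange : Set.range f ⊆ p.eval '' Set.Icc a b := by
    rw [hproj]
    rintro _ ⟨x, rfl⟩
    exact ⟨_, (Set.projIcc a b hab.le x).2, rfl⟩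
  obtain ⟨c, e, hce⟩ : ∃ c e : ℝ, p.eval '' Set.Icc a b ⊆ Set.Icc c e :=
    bddBelow_bddAbove_iff_subset_Icc.1
      ⟨(isCompact_Icc.image p.continuous).bddBelow, (isCompact_Icc.image p.continuous).bddAbove⟩
  have hmem : ∀ x, f x ∈ Set.Icc c e := fun x => hce (hrange ⟨x, rfl⟩)
  have hcast : ((n - 1 : ℕ) : ℝ) = (n : ℝ) - 1 := by
    rw [Nat.cast_sub (by omega), Nat.cast_one]
  rw [htop, ← hcast]
  refine coverEntropy_le_log_of_card_fiber_le hf (B := {p.eval a, p.eval b})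
    (Set.toFinite _).countable (by omega) ?_ ((hmem a).1.trans (hmem a).2)
    (fun x _ => hmem x) (closure_minimal (hrange.trans hce) isClosed_Icc)
  intro y hy
  simp only [Set.mem_insert_iff, Set.mem_singleton_iff, not_or] at hy
  refine ⟨(p - Polynomial.C y).roots.toFinset, ?_, ?_⟩
  · calc _ ≤ Multiset.card (p - Polynomial.C y).roots := Multiset.toFinset_card_le _
      _ ≤ (p - Polynomial.C y).natDegree := Polynomial.card_roots' _
      _ ≤ n - 1 := by rwa [Polynomial.natDegree_sub_C]
  · intro x hx
    simp only [hfdef] at hx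
    split_ifs at hx with h1 h2
    · exact absurd hx.symm hy.1
    · exact absurd hx.symm hy.2
    · have hne : p - Polynomial.C y ≠ 0 := by
        intro h0
        have := congrArg (Polynomial.eval a) h0
        simp only [Polynomial.eval_sub, Polynomial.eval_C, Polynomial.eval_zero] at this
        exact hy.1 (sub_eq_zero.1 this).symm
      simp [Polynomial.mem_roots hne, hx]
end

section
/- There exists an infinite-dimensional closed linear subspace Q of the Banach space of bounded continuous functions ℝ → ℝ (with the supremum norm) such that every f ∈ Q has finite topological entropy, h_top(f) < ∞. (Such a Q is the closed linear span of the functions f_{n,a}, n ≥ 1, a ∈ ℝ, where f_{n,a}(x) = a·(x − 2 + 1/n)·(2 − 1/(n+1) − x) for x ∈ [2 − 1/n, 2 − 1/(n+1)] and f_{n,a}(x) = 0 otherwise.) -/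
open BoundedContinuousFunction

section

open Set Metric

/-- The minimal size of a dynamical cover of a bounded set under a `K`-Lipschitz map of the line
grows at most like `K ^ n`. -/
lemma coverMincard_le_of_lipschitzWith {f : ℝ → ℝ} {K M E : ℕ} (hK : 1 ≤ K) (hE : 0 < E)
    (hf : LipschitzWith K f) {F : Set ℝ} (hF : F ⊆ Icc (-M) M) (n : ℕ) :
    Dynamics.coverMincard f F {p | dist p.1 p.2 < 1 / (E : ℝ)} n
      ≤ ((2 * M * E + 1) * K ^ n : ℕ) := by
  classical
  have hK0 : (1 : ℝ) ≤ K := by exact_mod_cast hK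
  have hE0 : (0 : ℝ) < E := by exact_mod_cast hE
  set D : ℝ := E * (K : ℝ) ^ n with hD
  have hD0 : 0 < D := by positivity
  set s : Finset ℝ :=
    (Finset.range (2 * M * (E * K ^ n) + 1)).image fun i : ℕ ↦ -(M : ℝ) + i / D with hs
  have hcover : Dynamics.IsDynCoverOf f F {p | dist p.1 p.2 < 1 / (E : ℝ)} n s := by
    intro x hx
    obtain ⟨hx1, hx2⟩ := hF hx
    have h0 : 0 ≤ (x + M) * D := mul_nonneg (by linarith) hD0.le
    set i := ⌊(x + M) * D⌋₊ with hi
    have hile := Nat.floor_le h0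
    have hilt := Nat.lt_floor_add_one ((x + M) * D)
    rw [← hi] at hile hilt
    refine ⟨-(M : ℝ) + i / D, ?_, ?_⟩
    · simp only [hs, Finset.coe_image, Set.mem_image, Finset.coe_range, Set.mem_Iio]
      refine ⟨i, ?_, rfl⟩
      rw [Nat.lt_succ_iff]
      have : (i : ℝ) ≤ 2 * M * D := hile.trans (by gcongr; linarith)
      rw [hD] at this
      exact_mod_cast this
    · have hdist : dist x (-(M : ℝ) + i / D) < 1 / D := by
        rw [Real.dist_eq, abs_lt, lt_div_iff₀ hD0, neg_lt, lt_div_iff₀ hD0]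
        have : (i : ℝ) / D * D = i := div_mul_cancel₀ _ hD0.ne'
        constructor <;> nlinarith
      refine Dynamics.mem_dynEntourage.2 fun k hk ↦ ?_
      have h1 := (hf.iterate k).dist_le_mul x (-(M : ℝ) + i / D)
      push_cast at h1
      have hkn : (K : ℝ) ^ k ≤ (K : ℝ) ^ n := pow_le_pow_right₀ hK0 hk.le
      refine h1.trans_lt ?_
      calc (K : ℝ) ^ k * dist x (-(M : ℝ) + i / D)
          ≤ (K : ℝ) ^ n * dist x (-(M : ℝ) + i / D) := by gcongr
        _ < (K : ℝ) ^ n * (1 / D) := by gcongr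
        _ = 1 / E := by rw [hD]; field_simp
  refine hcover.coverMincard_le_card.trans ?_
  have hcard : s.card ≤ (2 * M * E + 1) * K ^ n := by
    refine Finset.card_image_le.trans ?_
    rw [Finset.card_range]
    have := Nat.one_le_pow n K hK
    nlinarith
  exact_mod_cast hcard

/-- A Lipschitz map of the line has finite entropy on every bounded set. -/
lemma coverEntropy_lt_top_of_lipschitzWith {f : ℝ → ℝ} {K : ℕ} (hK : 1 ≤ K)
    (hf : LipschitzWith K f) {F : Set ℝ} {M : ℕ} (hF : F ⊆ Icc (-M) M) :
    Dynamics.coverEntropy f F < ⊤ := by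
  have hlog : ENNReal.log (K : ENNReal) < ⊤ := by
    rw [ENNReal.log_lt_top_iff]
    exact ENNReal.natCast_lt_top K
  refine lt_of_le_of_lt ?_ hlog
  refine iSup₂_le fun U hU ↦ ?_
  obtain ⟨ε, hε, hεU⟩ := Metric.mem_uniformity_dist.1 hU
  obtain ⟨m, hm⟩ := exists_nat_one_div_lt hε
  have hsub : ({p | dist p.1 p.2 < 1 / ((m + 1 : ℕ) : ℝ)} : Set (ℝ × ℝ)) ⊆ U := by
    rintro ⟨a, b⟩ hab
    refine hεU (lt_trans hab ?_)
    exact_mod_cast hm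
  refine (Dynamics.coverEntropyEntourage_antitone f F hsub).trans ?_
  rw [← ExpGrowth.expGrowthSup_pow (b := (K : ENNReal))]
  refine ExpGrowth.expGrowthSup_le_of_eventually_le
    (b := ((2 * M * (m + 1) + 1 : ℕ) : ENNReal)) (ENNReal.natCast_ne_top _)
    (Filter.Eventually.of_forall fun n ↦ ?_)
  have h := ENat.toENNReal_mono
    (coverMincard_le_of_lipschitzWith hK (Nat.succ_pos m) hf hF n)
  refine h.trans (le_of_eq ?_)
  push_cast
  rfl

/-- The bounded continuous functions that are affine on each interval `[n, n + 1]`, `n : ℤ`. -/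
def piecewiseAffine : Submodule ℝ (ℝ →ᵇ ℝ) where
  carrier := {f | ∀ (n : ℤ) (t : Icc (0 : ℝ) 1),
    f (n + t) = (1 - t) * f n + t * f (n + 1)}
  add_mem' {f g} hf hg n t := by
    simp only [BoundedContinuousFunction.coe_add, Pi.add_apply, hf n t, hg n t]
    ring
  zero_mem' n t := by simp
  smul_mem' c f hf n t := by
    simp only [BoundedContinuousFunction.coe_smul, smul_eq_mul, hf n t]
    ring

lemma isClosed_piecewiseAffine : IsClosed (piecewiseAffine : Set (ℝ →ᵇ ℝ)) := by
  have heq : (piecewiseAffine : Set (ℝ →ᵇ ℝ)) = ⋂ (n : ℤ) (t : Icc (0 : ℝ) 1),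
      {f : ℝ →ᵇ ℝ | f (n + t) = (1 - (t : ℝ)) * f n + t * f (n + 1)} := by
    ext f
    simp only [mem_iInter]
    rfl
  rw [heq]
  refine isClosed_iInter fun n ↦ isClosed_iInter fun t ↦ isClosed_eq ?_ ?_ <;>
  · have := fun x : ℝ ↦ (BoundedContinuousFunction.evalCLM ℝ (β := ℝ) x).continuous
    fun_prop

lemma dist_le_of_mem_piecewiseAffine {f : ℝ →ᵇ ℝ} (hf : f ∈ piecewiseAffine) (n : ℤ)
    {s t : ℝ} (hs : 0 ≤ s) (hst : s ≤ t) (ht : t ≤ 1) :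
    |f (n + t) - f (n + s)| ≤ 2 * ‖f‖ * (t - s) := by
  have h1 : f (n + t) = _ := hf n ⟨t, hs.trans hst, ht⟩
  have h2 : f (n + s) = _ := hf n ⟨s, hs, hst.trans ht⟩
  have h3 : f (n + t) - f (n + s) = (f (n + 1) - f n) * (t - s) := by
    rw [h1, h2]; ring
  rw [h3, abs_mul, abs_of_nonneg (sub_nonneg.2 hst)]
  have := f.dist_le_two_norm (n + 1) n
  rw [Real.dist_eq] at this
  gcongr

lemma lipschitzWith_of_mem_piecewiseAffine {f : ℝ →ᵇ ℝ} (hf : f ∈ piecewiseAffine) :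
    LipschitzWith (2 * ‖f‖₊) f := by
  have key (x y : ℝ) (hxy : x ≤ y) : |f y - f x| ≤ 2 * ‖f‖ * (y - x) := by
    have hx0 := Int.fract_nonneg x
    have hx1 := (Int.fract_lt_one x).le
    have hy0 := Int.fract_nonneg y
    have hy1 := (Int.fract_lt_one y).le
    have hx := Int.floor_add_fract x
    have hy := Int.floor_add_fract y
    set m := ⌊x⌋
    set n := ⌊y⌋
    set s := Int.fract x
    set t := Int.fract y
    obtain hmn | hmn := (show m ≤ n from Int.floor_mono hxy).eq_or_lt
    · have h := dist_le_of_mem_piecewiseAffine hf m hx0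
        (t := t) (by rw [← hmn] at hy; linarith) hy1
      rw [hx] at h
      rw [hmn, hy] at h
      rwa [show t - s = y - x by rw [← hx, ← hy, hmn]; ring] at h
    · have h1 := dist_le_of_mem_piecewiseAffine hf m hx0 hx1 le_rfl
      have h2 := dist_le_of_mem_piecewiseAffine hf n le_rfl hy0 hy1
      have h3 : |f (n + 0) - f (m + 1)| ≤ 2 * ‖f‖ * (n - (m + 1)) := by
        obtain h | h := (show m + 1 ≤ n from hmn).eq_or_lt
        · simp [← h]
        · have h4 : (1 : ℝ) ≤ n - (m + 1) := by
            have : m + 1 + 1 ≤ n := h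
            have : ((m + 1 + 1 : ℤ) : ℝ) ≤ n := by exact_mod_cast this
            push_cast at this
            linarith
          have h5 := f.dist_le_two_norm (n + 0) (m + 1)
          rw [Real.dist_eq] at h5
          exact h5.trans (le_mul_of_one_le_right (by positivity) h4)
      rw [hx] at h1
      rw [hy] at h2
      calc |f y - f x|
          = |(f y - f (n + 0)) + (f (n + 0) - f (m + 1)) + (f (m + 1) - f x)| := by
            congr 1; ring
        _ ≤ |f y - f (n + 0)| + |f (n + 0) - f (m + 1)| + |f (m + 1) - f x| :=
            abs_add_three _ _ _
        _ ≤ 2 * ‖f‖ * (t - 0) + 2 * ‖f‖ * (n - (m + 1)) + 2 * ‖f‖ * (1 - s) := by gcongr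
        _ = 2 * ‖f‖ * (y - x) := by rw [← hx, ← hy]; ring
  refine LipschitzWith.of_dist_le_mul fun x y ↦ ?_
  simp only [NNReal.coe_mul, NNReal.coe_ofNat, coe_nnnorm, Real.dist_eq]
  obtain h | h := le_total x y
  · rw [abs_sub_comm, abs_sub_comm x, abs_of_nonneg (sub_nonneg.2 h)]
    exact key x y h
  · rw [abs_of_nonneg (sub_nonneg.2 h)]
    exact key y x h

/-- The tent function of height one supported on `[n - 1, n + 1]`. -/
noncomputable def tent (n : ℕ) : ℝ →ᵇ ℝ :=
  BoundedContinuousFunction.ofNormedAddCommGroup (fun x ↦ max 0 (1 - |x - n|)) (by fun_prop) 1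
    fun x ↦ by
      rw [Real.norm_eq_abs, abs_of_nonneg (le_max_left _ _)]
      exact max_le zero_le_one (by linarith [abs_nonneg (x - n)])

lemma tent_apply (n : ℕ) (x : ℝ) : tent n x = max 0 (1 - |x - n|) := rfl

lemma tent_mem_piecewiseAffine (n : ℕ) : tent n ∈ piecewiseAffine := by
  rintro k ⟨t, ht0, ht1⟩
  simp only [tent_apply]
  obtain ⟨j, rfl⟩ : ∃ j : ℤ, k = j + n := ⟨k - n, by ring⟩
  push_cast
  rw [show (j : ℝ) + n + t - n = j + t by ring, show (j : ℝ) + n - n = j by ring,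
    show (j : ℝ) + n + 1 - n = j + 1 by ring]
  obtain h | rfl | rfl | h : j ≤ -2 ∨ j = -1 ∨ j = 0 ∨ 1 ≤ j := by omega
  · have hj : (j : ℝ) ≤ -2 := by exact_mod_cast h
    rw [abs_of_nonpos (by linarith), abs_of_nonpos (by linarith), abs_of_nonpos (by linarith),
      max_eq_left (by linarith), max_eq_left (by linarith), max_eq_left (by linarith)]
    ring
  · push_cast
    rw [abs_of_nonpos (by linarith), max_eq_right (by linarith)]
    norm_num
  · push_cast
    rw [abs_of_nonneg (by linarith), max_eq_right (by linarith)]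
    norm_num
  · have hj : (1 : ℝ) ≤ j := by exact_mod_cast h
    rw [abs_of_nonneg (by linarith), abs_of_nonneg (by linarith), abs_of_nonneg (by linarith),
      max_eq_left (by linarith), max_eq_left (by linarith), max_eq_left (by linarith)]
    ring

lemma tent_natCast (n m : ℕ) : tent n m = if n = m then 1 else 0 := by
  rw [tent_apply]
  split_ifs with h
  · simp [h]
  · refine max_eq_left ?_
    have : (1 : ℤ) ≤ |(m : ℤ) - n| := Int.one_le_abs (by omega)
    have : (1 : ℝ) ≤ |(m : ℝ) - n| := by exact_mod_cast this
    linarith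

lemma linearIndependent_tent : LinearIndependent ℝ tent := by
  rw [linearIndependent_iff']
  intro s g hg i hi
  have h := congrArg (fun f : ℝ →ᵇ ℝ ↦ f (i : ℝ)) hg
  simpa [tent_natCast, hi] using h

lemma not_finite_piecewiseAffine : ¬ Module.Finite ℝ piecewiseAffine := by
  intro hfin
  have h : LinearIndependent ℝ
      fun n : ℕ ↦ (⟨tent n, tent_mem_piecewiseAffine n⟩ : piecewiseAffine) :=
    LinearIndependent.of_comp piecewiseAffine.subtype linearIndependent_tent
  exact Module.Finite.not_linearIndependent_of_infinite _ h

end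

theorem exists_infinite_dim_closed_subspace_finite_entropy :
    ∃ Q : Submodule ℝ (ℝ →ᵇ ℝ),
      IsClosed (Q : Set (ℝ →ᵇ ℝ)) ∧ ¬ Module.Finite ℝ Q ∧
      ∀ f ∈ Q, htop f < ⊤ := by
  refine ⟨piecewiseAffine, isClosed_piecewiseAffine, not_finite_piecewiseAffine, fun f hf ↦ ?_⟩
  obtain ⟨M, hM⟩ := exists_nat_ge ‖f‖
  obtain ⟨K, hK⟩ := exists_nat_ge (2 * ‖f‖₊)
  refine coverEntropy_lt_top_of_lipschitzWith (K := K + 1) (M := M) (Nat.le_add_left 1 K)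
    ((lipschitzWith_of_mem_piecewiseAffine hf).weaken ?_) ?_
  · push_cast
    exact hK.trans (le_add_of_nonneg_right zero_le_one)
  · refine closure_minimal ?_ isClosed_Icc
    rintro _ ⟨x, rfl⟩
    exact abs_le.1 ((f.norm_coe_le_norm x).trans hM)
end

section
/- Let A be a closed linear subspace of C([0,1]) (continuous real-valued functions on [0,1] with the supremum norm) that is isometrically isomorphic to ℓ¹, the Banach space of real sequences summable in absolute value with the 1-norm. Then A contains a function f with infinite topological entropy, h_top(f) = ∞. -/
open BoundedContinuousFunction

/-- The extension of `f ∈ C([0,1])` to a bounded continuous function on `ℝ`,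
constant to the left of `0` and to the right of `1`. -/
noncomputable def extCI (f : C(↥(Set.Icc (0 : ℝ) 1), ℝ)) : ℝ → ℝ :=
  fun x => f ⟨min (max x 0) 1,
    ⟨le_min (le_max_right x 0) zero_le_one, min_le_right _ 1⟩⟩

/-- If each of `m` uniformly separated pieces of `J` is mapped over all of `J`, then every
itinerary is realized, so the entropy is at least `log m`. -/
theorem log_le_coverEntropy_of_separated {X : Type*} [PseudoMetricSpace X] {f : X → X}
    {F J : Set X} {m : ℕ} [NeZero m] (I : Fin m → Set X) (hJ : J.Nonempty) (hJF : J ⊆ F)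
    (hIJ : ∀ i, I i ⊆ J) (hf : ∀ i, J ⊆ f '' I i) {δ : ℝ} (hδ : 0 < δ)
    (hsep : ∀ i j, i ≠ j → ∀ x ∈ I i, ∀ y ∈ I j, 2 * δ ≤ dist x y) :
    ENNReal.log m ≤ Dynamics.coverEntropy f F := by
  classical
  have itinerary : ∀ n : ℕ, ∀ w : ℕ → Fin m, ∃ x ∈ J, ∀ k < n, f^[k] x ∈ I (w k) := by
    intro n
    induction n with
    | zero => exact fun w => ⟨hJ.some, hJ.some_mem, by simp⟩
    | succ n ih =>
      intro w
      obtain ⟨y, hy, hyw⟩ := ih fun k => w (k + 1)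
      obtain ⟨x, hx, rfl⟩ := hf (w 0) hy
      refine ⟨x, hIJ _ hx, fun k hk => ?_⟩
      cases k with
      | zero => exact hx
      | succ k => exact hyw k (by omega)
  have hcard : ∀ n : ℕ, (m : ℕ∞) ^ n ≤
      Dynamics.netMaxcard f F {p : X × X | dist p.1 p.2 < δ} n := by
    intro n
    have h : ∀ w : Fin n → Fin m, ∃ x ∈ J, ∀ k : Fin n, f^[k] x ∈ I (w k) := by
      intro w
      obtain ⟨x, hx, hw⟩ := itinerary n fun k => if h : k < n then w ⟨k, h⟩ else 0
      refine ⟨x, hx, fun k => ?_⟩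
      simpa using hw k k.2
    choose x hxJ hx using h
    have sep : ∀ v w : Fin n → Fin m, v ≠ w → ∃ k : Fin n,
        2 * δ ≤ dist (f^[k] (x v)) (f^[k] (x w)) := by
      intro v w hvw
      obtain ⟨k, hk⟩ := Function.ne_iff.1 hvw
      exact ⟨k, hsep _ _ hk _ (hx v k) _ (hx w k)⟩
    have hinj : Function.Injective x := by
      intro v w hvw
      by_contra hne
      obtain ⟨k, hk⟩ := sep v w hne
      rw [hvw, dist_self] at hk
      linarith
    have hnet : Dynamics.IsDynNetIn f F {p : X × X | dist p.1 p.2 < δ} n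
        (Finset.univ.image x : Finset X) := by
      refine ⟨?_, ?_⟩
      · intro y hy
        obtain ⟨w, -, rfl⟩ := Finset.mem_image.1 (Finset.mem_coe.1 hy)
        exact hJF (hxJ w)
      · intro y hy z hz hyz
        obtain ⟨v, -, rfl⟩ := Finset.mem_image.1 (Finset.mem_coe.1 hy)
        obtain ⟨w, -, rfl⟩ := Finset.mem_image.1 (Finset.mem_coe.1 hz)
        obtain ⟨k, hk⟩ := sep v w fun h => hyz (h ▸ rfl)
        refine Set.disjoint_left.2 fun u hu hu' => ?_
        have h1 : dist (f^[k] (x v)) (f^[k] u) < δ := Dynamics.mem_ball_dynEntourage.1 hu k k.2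
        have h2 : dist (f^[k] (x w)) (f^[k] u) < δ := Dynamics.mem_ball_dynEntourage.1 hu' k k.2
        have := dist_triangle_right (f^[k] (x v)) (f^[k] (x w)) (f^[k] u)
        linarith
    have := hnet.card_le_netMaxcard
    rw [Finset.card_image_of_injective _ hinj] at this
    simpa using this
  calc ENNReal.log m = ExpGrowth.expGrowthSup fun n => (m : ENNReal) ^ n :=
        ExpGrowth.expGrowthSup_pow.symm
    _ ≤ Dynamics.netEntropyEntourage f F {p : X × X | dist p.1 p.2 < δ} := by
        refine ExpGrowth.expGrowthSup_monotone fun n => ?_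
        have := ENat.toENNReal_mono (hcard n)
        simpa using this
    _ ≤ _ := Dynamics.netEntropyEntourage_le_coverEntropy _ _ (Metric.dist_mem_uniformity hδ)

/-- A continuous map whose values at `s 0 < ⋯ < s k` in `[u, v]` alternate between being at most
`u` and at least `v` has entropy at least `log ((k + 1) / 2)`. -/
theorem log_le_htop_of_alternating {f : ℝ → ℝ} (hf : Continuous f) {u v : ℝ} {k m : ℕ} [NeZero m]
    (hm : 2 * m ≤ k + 1) {s : ℕ → ℝ} (hs : ∀ i < k, s i < s (i + 1))
    (hmem : ∀ i ≤ k, s i ∈ Set.Icc u v)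
    (halt : ∀ i < k, f (s i) ≤ u ∧ v ≤ f (s (i + 1)) ∨ v ≤ f (s i) ∧ f (s (i + 1)) ≤ u) :
    ENNReal.log m ≤ htop f := by
  have hm0 : 0 < m := Nat.pos_of_ne_zero (NeZero.ne m)
  have mono : ∀ i j, i ≤ j → j ≤ k → s i ≤ s j := by
    intro i j hij
    induction j, hij using Nat.le_induction with
    | base => exact fun _ => le_rfl
    | succ j hij ih => exact fun hj => (ih (by omega)).trans (hs j (by omega)).le
  have cover : ∀ i : Fin m, Set.Icc u v ⊆ f '' Set.Icc (s (2 * i)) (s (2 * i + 1)) := by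
    intro i
    have hi : 2 * (i : ℕ) < k := by omega
    rcases halt (2 * i) hi with h | h
    · exact (Set.Icc_subset_Icc h.1 h.2).trans
        (intermediate_value_Icc (hs _ hi).le hf.continuousOn)
    · exact (Set.Icc_subset_Icc h.2 h.1).trans
        (intermediate_value_Icc' (hs _ hi).le hf.continuousOn)
  obtain ⟨δ, hδ, hgap⟩ : ∃ δ > 0, ∀ i < k, 2 * δ ≤ s (i + 1) - s i := by
    obtain ⟨i₀, hi₀, hmin⟩ := Finset.exists_min_image (Finset.range k)
      (fun i => s (i + 1) - s i) ⟨0, Finset.mem_range.2 (by omega)⟩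
    refine ⟨(s (i₀ + 1) - s i₀) / 2, ?_, fun i hi => ?_⟩
    · have := hs i₀ (Finset.mem_range.1 hi₀)
      linarith
    · have := hmin i (Finset.mem_range.2 hi)
      linarith
  have sep : ∀ i j : Fin m, i < j → ∀ x ∈ Set.Icc (s (2 * i)) (s (2 * i + 1)),
      ∀ y ∈ Set.Icc (s (2 * j)) (s (2 * j + 1)), 2 * δ ≤ y - x := by
    intro i j hij x hx y hy
    have hij' : (i : ℕ) < j := hij
    have h1 := hgap (2 * i + 1) (by omega)
    have h2 := mono (2 * i + 1 + 1) (2 * j) (by omega) (by omega)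
    linarith [hx.2, hy.1]
  refine log_le_coverEntropy_of_separated (J := Set.Icc u v)
    (fun i : Fin m => Set.Icc (s (2 * i)) (s (2 * i + 1)))
    ⟨s 0, hmem 0 (by omega)⟩ ?_ ?_ cover hδ ?_
  · exact (cover 0).trans ((Set.image_subset_range _ _).trans subset_closure)
  · exact fun i => Set.Icc_subset_Icc (hmem _ (by omega)).1 (hmem _ (by omega)).2
  · intro i j hij x hx y hy
    rcases lt_or_gt_of_ne hij with h | h
    · exact (sep i j h x hx y hy).trans (by rw [dist_comm]; exact le_abs_self _)
    · exact (sep j i h y hy x hx).trans (le_abs_self _)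

/-- `IsAlternating S e k s` says that `s 0 < ⋯ < s k` are points of `S` at which consecutive
values of `e` differ. -/
def IsAlternating {X : Type*} [LT X] (S : Set X) (e : X → ℝ) (k : ℕ) (s : ℕ → X) : Prop :=
  (∀ i ≤ k, s i ∈ S) ∧ ∀ i < k, s i < s (i + 1) ∧ e (s i) ≠ e (s (i + 1))

theorem IsAlternating.update_succ {X : Type*} [LT X] {S : Set X} {e : X → ℝ} {k : ℕ} {s : ℕ → X}
    (h : IsAlternating S e k s) {t : X} (ht : t ∈ S) (hlt : s k < t) (hne : e (s k) ≠ e t) :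
    IsAlternating S e (k + 1) (Function.update s (k + 1) t) := by
  refine ⟨fun i hi => ?_, fun i hi => ?_⟩
  · rcases hi.eq_or_lt with rfl | hi
    · simpa using ht
    · rw [Function.update_of_ne hi.ne]
      exact h.1 i (by omega)
  · rw [Function.update_of_ne hi.ne]
    rcases (Nat.lt_succ_iff.1 hi).eq_or_lt with rfl | hi'
    · simpa using ⟨hlt, hne⟩
    · rw [Function.update_of_ne (by omega)]
      exact h.2 i hi'

theorem IsAlternating.update_last {X : Type*} [Preorder X] {S : Set X} {e : X → ℝ} {k : ℕ}
    {s : ℕ → X} (h : IsAlternating S e k s) {t : X} (ht : t ∈ S) (hlt : s k < t)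
    (heq : e (s k) = e t) : IsAlternating S e k (Function.update s k t) := by
  refine ⟨fun i hi => ?_, fun i hi => ?_⟩
  · rcases hi.eq_or_lt with rfl | hi
    · simpa using ht
    · rw [Function.update_of_ne hi.ne]
      exact h.1 i (by omega)
  · rw [Function.update_of_ne hi.ne]
    by_cases hk : i + 1 = k
    · subst hk
      simpa using ⟨(h.2 i hi).1.trans hlt, heq ▸ (h.2 i hi).2⟩
    · rw [Function.update_of_ne hk]
      exact h.2 i hi

/-- If the alternations on `S` have length at most `D`, then the number of alternations before a
point is a counting function, constant only where `e` is constant. -/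
theorem exists_counting_function {X : Type*} [LinearOrder X] {S : Set X} {e : X → ℝ} {D : ℕ}
    (hD : ∀ k s, IsAlternating S e k s → k ≤ D) :
    ∃ c : X → ℕ, (∀ t, c t ≤ D) ∧ (∀ s ∈ S, ∀ t ∈ S, s < t → c s ≤ c t) ∧
      ∀ s ∈ S, ∀ t ∈ S, s < t → e s ≠ e t → c s < c t := by
  classical
  let P : X → ℕ → Prop := fun t k => ∃ s, IsAlternating S e k s ∧ s k = t
  have hP : ∀ t ∈ S, P t (Nat.findGreatest (P t) D) := fun t ht =>
    Nat.findGreatest_spec (m := 0) (Nat.zero_le D) ⟨fun _ => t, ⟨fun _ _ => ht, by simp⟩, rfl⟩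
  have hlt : ∀ s ∈ S, ∀ t ∈ S, s < t → e s ≠ e t →
      Nat.findGreatest (P s) D < Nat.findGreatest (P t) D := by
    intro s hs t ht hst hne
    obtain ⟨a, ha, has⟩ := hP s hs
    have := ha.update_succ ht (has.trans_lt hst) (by rwa [has])
    exact Nat.le_findGreatest (hD _ _ this) ⟨_, this, by simp⟩
  refine ⟨fun t => Nat.findGreatest (P t) D, fun t => Nat.findGreatest_le D, ?_, hlt⟩
  intro s hs t ht hst
  by_cases hne : e s = e t
  · obtain ⟨a, ha, has⟩ := hP s hs
    have := ha.update_last ht (has.trans_lt hst) (by rwa [has])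
    exact Nat.le_findGreatest (hD _ _ this) ⟨_, this, by simp⟩
  · exact (hlt s hs t ht hst hne).le

/-- If the alternations of every `e n` on `S` have length at most `D`, then `e 0, …, e (N - 1)`
realize at most `N * D + 1` patterns on `S`. -/
theorem encard_patterns_le {X : Type*} [LinearOrder X] {S : Set X} {e : ℕ → X → ℝ} {D : ℕ}
    (hD : ∀ n k s, IsAlternating S (e n) k s → k ≤ D) (N : ℕ) :
    ((fun (t : X) (n : Fin N) => e n t) '' S).encard ≤ (N * D + 1 : ℕ) := by
  choose c hcD hmono hlt using fun n => exists_counting_function (hD n)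
  set φ : X → Fin N → ℝ := fun t n => e n t
  have hinj : ∀ s ∈ S, ∀ t ∈ S, s < t →
      ∑ n : Fin N, c n s = ∑ n : Fin N, c n t → φ s = φ t := by
    intro s hs t ht hst h
    funext n
    by_contra hne
    exact (Finset.sum_lt_sum (s := Finset.univ) (fun (n : Fin N) _ => hmono n s hs t ht hst)
      ⟨n, Finset.mem_univ n, hlt n s hs t ht hst hne⟩).ne h
  have hbound : ∀ t, ∑ n : Fin N, c n t ∈ (Finset.range (N * D + 1) : Set ℕ) := by
    intro t
    have : ∑ n : Fin N, c n t ≤ ∑ _n : Fin N, D := Finset.sum_le_sum fun n _ => hcD n t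
    simp at this
    simp
    omega
  rcases S.eq_empty_or_nonempty with rfl | ⟨x₀, -⟩
  · simp
  have : Nonempty X := ⟨x₀⟩
  choose! r hrS hr using fun y (hy : y ∈ φ '' S) => hy
  calc (φ '' S).encard ≤ (Finset.range (N * D + 1) : Set ℕ).encard := by
        refine Set.encard_le_encard_of_injOn (f := fun y => ∑ n : Fin N, c n (r y))
          (fun y _ => hbound _) ?_
        intro y hy z hz hyz
        rw [← hr y hy, ← hr z hz]
        rcases lt_trichotomy (r y) (r z) with h | h | h
        · exact hinj _ (hrS y hy) _ (hrS z hz) h hyz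
        · rw [h]
        · exact (hinj _ (hrS z hz) _ (hrS y hy) h hyz.symm).symm
    _ = (N * D + 1 : ℕ) := by rw [Set.encard_coe_eq_coe_finsetCard, Finset.card_range]

/-- If the maps `e n` realize every sequence of signs up to a global sign, then at some point,
on one of its two sides, they alternate arbitrarily often arbitrarily close to it. -/
theorem exists_unbounded_alternation (e : ℕ → C(↥(Set.Icc (0 : ℝ) 1), ℝ))
    (he : ∀ ε : ℕ → ℝ, (∀ n, |ε n| = 1) → ∃ t, (∀ n, e n t = ε n) ∨ ∀ n, e n t = -ε n) :
    ∃ p : ↥(Set.Icc (0 : ℝ) 1), (∀ n, |e n p| = 1) ∧ ∃ σ : ℝ, |σ| = 1 ∧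
      ∀ η > 0, ∀ D : ℕ, ∃ n k s, D < k ∧
        IsAlternating {t | (∀ n, |e n t| = 1) ∧ 0 < σ * (t - p : ℝ) ∧ σ * (t - p : ℝ) < η}
          (e n) k s := by
  by_contra! hcon
  set K : Set ↥(Set.Icc (0 : ℝ) 1) := {t | ∀ n, |e n t| = 1} with hK
  have hKc : IsCompact K := by
    refine IsClosed.isCompact ?_
    rw [hK, Set.ofPred_forall]
    exact isClosed_iInter fun n => isClosed_eq (e n).continuous.abs continuous_const
  let φ : (N : ℕ) → ↥(Set.Icc (0 : ℝ) 1) → Fin N → ℝ := fun N t n => e n t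
  have hcount : ∃ C : ℕ, ∀ N, (φ N '' K).encard ≤ (C * (N + 1) : ℕ) := by
    refine hKc.induction_on (p := fun S => ∃ C : ℕ, ∀ N, (φ N '' S).encard ≤ (C * (N + 1) : ℕ))
      ⟨0, by simp⟩ ?_ ?_ ?_
    · rintro S T hST ⟨C, hC⟩
      exact ⟨C, fun N => (Set.encard_le_encard (Set.image_mono hST)).trans (hC N)⟩
    · rintro S T ⟨C, hC⟩ ⟨C', hC'⟩
      refine ⟨C + C', fun N => ?_⟩
      rw [Set.image_union, add_mul, Nat.cast_add]
      exact (Set.encard_union_le _ _).trans (add_le_add (hC N) (hC' N))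
    · intro p hp
      obtain ⟨η₁, hη₁, D₁, h₁⟩ := hcon p hp 1 (by simp)
      obtain ⟨η₂, hη₂, D₂, h₂⟩ := hcon p hp (-1) (by simp)
      refine ⟨Metric.ball p (min η₁ η₂) ∩ K, Filter.inter_mem
        (mem_nhdsWithin_of_mem_nhds (Metric.ball_mem_nhds p (lt_min hη₁ hη₂)))
        self_mem_nhdsWithin, D₁ + D₂ + 3, fun N => ?_⟩
      have hsub : Metric.ball p (min η₁ η₂) ∩ K ⊆
          ({t | (∀ n, |e n t| = 1) ∧ 0 < 1 * (t - p : ℝ) ∧ 1 * (t - p : ℝ) < η₁} ∪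
          {t | (∀ n, |e n t| = 1) ∧ 0 < -1 * (t - p : ℝ) ∧ -1 * (t - p : ℝ) < η₂}) ∪ {p} := by
        rintro t ⟨ht, htK⟩
        have ht' : |(t : ℝ) - p| < min η₁ η₂ := ht
        obtain ⟨ha, hb⟩ := lt_min_iff.1 ht'
        rcases lt_trichotomy t p with h | h | h
        · have h' : (t : ℝ) < p := h
          exact .inl (.inr ⟨htK, by linarith, by linarith [neg_abs_le ((t : ℝ) - p)]⟩)
        · exact .inr h
        · have h' : (p : ℝ) < t := h
          exact .inl (.inl ⟨htK, by linarith, by linarith [le_abs_self ((t : ℝ) - p)]⟩)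
      have e₁ := encard_patterns_le (e := fun n => e n) (D := D₁)
        (fun n k s h => not_lt.1 fun hk => h₁ n k s hk h) N
      have e₂ := encard_patterns_le (e := fun n => e n) (D := D₂)
        (fun n k s h => not_lt.1 fun hk => h₂ n k s hk h) N
      refine (Set.encard_le_encard (Set.image_mono hsub)).trans ?_
      rw [Set.image_union, Set.image_union, Set.image_singleton]
      refine (Set.encard_union_le _ _).trans ((add_le_add ((Set.encard_union_le _ _).trans
        (add_le_add e₁ e₂)) (Set.encard_singleton _).le).trans ?_)
      norm_cast
      nlinarith
  obtain ⟨C, hC⟩ := hcount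
  have hpow : ∀ N, 2 ^ N ≤ C * (N + 1) + C * (N + 1) := by
    intro N
    let ι : (Fin N → Bool) → Fin N → ℝ := fun b n => if b n then 1 else -1
    have hι : Function.Injective ι := by
      intro b c hbc
      funext n
      have := congr_fun hbc n
      revert this
      cases hb : b n <;> cases hc : c n <;> simp [ι, hb, hc] <;> norm_num
    have hrange : Set.range ι ⊆ φ N '' K ∪ Neg.neg '' (φ N '' K) := by
      rintro _ ⟨b, rfl⟩
      obtain ⟨t, ht⟩ := he (fun n => if h : n < N then ι b ⟨n, h⟩ else 1) (by
        intro n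
        simp only [ι]
        split_ifs <;> simp)
      rcases ht with ht | ht
      · refine .inl ⟨t, fun n => ?_, ?_⟩
        · rw [ht]
          simp only [ι]
          split_ifs <;> simp
        · funext n
          simp [φ, ht]
      · refine .inr ⟨_, ⟨t, fun n => ?_, rfl⟩, ?_⟩
        · rw [ht]
          simp only [ι]
          split_ifs <;> simp
        · funext n
          simp [φ, ht]
    have := (Set.encard_le_encard hrange).trans ((Set.encard_union_le _ _).trans
      (add_le_add (hC N) ((Set.encard_image_le _ _).trans (hC N))))
    rw [← Set.image_univ, hι.encard_image, Set.encard_univ] at this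
    simp only [ENat.card_eq_coe_fintype_card, Fintype.card_fun, Fintype.card_bool,
      Fintype.card_fin] at this
    exact_mod_cast this
  have h1 := hpow (4 * C + 4 * C)
  have h2 : 4 * C + 1 ≤ 2 ^ (4 * C) := Nat.lt_two_pow_self
  rw [pow_add] at h1
  nlinarith [Nat.mul_le_mul h2 h2]

/-- The images of the unit vectors of `ℓ¹` realize every sequence of signs, up to a global sign,
at some point of the interval. -/
theorem exists_sign_functions (A : Submodule ℝ C(↥(Set.Icc (0 : ℝ) 1), ℝ))
    (Φ : A ≃ₗᵢ[ℝ] lp (fun _ : ℕ => ℝ) 1) :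
    ∃ e : ℕ → C(↥(Set.Icc (0 : ℝ) 1), ℝ), (∀ n, e n ∈ A) ∧ (∀ n, ‖e n‖ = 1) ∧
      ∀ ε : ℕ → ℝ, (∀ n, |ε n| = 1) →
        ∃ t, (∀ n, e n t = ε n) ∨ ∀ n, e n t = -ε n := by
  have hnorm : ∀ n, ‖(Φ.symm (lp.single 1 n 1) : C(↥(Set.Icc (0 : ℝ) 1), ℝ))‖ = 1 := by
    intro n
    rw [Submodule.norm_coe, Φ.symm.norm_map, lp.norm_single (by norm_num), norm_one]
  refine ⟨fun n => Φ.symm (lp.single 1 n 1), fun n => Submodule.coe_mem _, hnorm, fun ε hε => ?_⟩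
  set e : ℕ → C(↥(Set.Icc (0 : ℝ) 1), ℝ) := fun n => Φ.symm (lp.single 1 n 1)
  have hgeom : HasSum (fun n : ℕ => (1 : ℝ) / 2 / 2 ^ n) 1 := hasSum_geometric_two' 1
  have habs : ∀ n, ‖(1 : ℝ) / 2 / 2 ^ n * ε n‖ = 1 / 2 / 2 ^ n := by
    intro n
    rw [norm_mul, Real.norm_eq_abs (ε n), hε, mul_one, Real.norm_of_nonneg (by positivity)]
  let x : lp (fun _ : ℕ => ℝ) 1 := ⟨fun n => 1 / 2 / 2 ^ n * ε n, by
    refine memℓp_gen ?_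
    simpa only [ENNReal.toReal_one, Real.rpow_one, habs] using hgeom.summable⟩
  have hx : ‖x‖ = 1 := by
    have h := lp.hasSum_norm (p := 1) (by norm_num) x
    simp only [ENNReal.toReal_one, Real.rpow_one] at h
    refine h.unique ?_
    simpa only [x, habs] using hgeom
  set F : C(↥(Set.Icc (0 : ℝ) 1), ℝ) := (Φ.symm x).1
  have hF : ‖F‖ = 1 := by
    rw [Submodule.norm_coe, Φ.symm.norm_map, hx]
  have heval : ∀ t, HasSum (fun n => 1 / 2 / 2 ^ n * ε n * e n t) (F t) := by
    intro t
    let L : lp (fun _ : ℕ => ℝ) 1 →L[ℝ] ℝ := (ContinuousMap.evalCLM ℝ t).comp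
      (A.subtypeL.comp (Φ.symm.toContinuousLinearEquiv : lp (fun _ : ℕ => ℝ) 1 →L[ℝ] A))
    have hL : HasSum (fun n => L (lp.single 1 n (x n))) (L x) :=
      L.hasSum (lp.hasSum_single ENNReal.one_ne_top x)
    have hterm : ∀ n, L (lp.single 1 n (x n)) = 1 / 2 / 2 ^ n * ε n * e n t := by
      intro n
      have : lp.single (E := fun _ : ℕ => ℝ) 1 n (x n) =
          (1 / 2 / 2 ^ n * ε n) • lp.single (E := fun _ : ℕ => ℝ) 1 n 1 := by
        rw [← lp.single_smul, smul_eq_mul, mul_one]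
      rw [this, map_smul]
      rfl
    exact hL.congr_fun fun n => (hterm n).symm
  obtain ⟨t, ht⟩ : ∃ t, |F t| = 1 := by
    obtain ⟨t, -, ht⟩ := isCompact_univ.exists_isMaxOn Set.univ_nonempty
      (F.continuous.abs.continuousOn)
    refine ⟨t, le_antisymm ((F.norm_coe_le_norm t).trans hF.le) (hF.ge.trans ?_)⟩
    exact (ContinuousMap.norm_le F (abs_nonneg _)).2 fun y => ht (Set.mem_univ y)
  have key : ∀ θ : ℝ, |θ| = 1 → θ * F t = 1 → ∀ n, e n t = θ * ε n := by
    intro θ hθ hθF n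
    have hsum : HasSum (fun n => 1 / 2 / 2 ^ n * (1 - θ * ε n * e n t)) 0 := by
      have := hgeom.sub ((heval t).mul_left θ)
      rw [hθF, sub_self] at this
      refine this.congr_fun ?_
      intro n
      ring
    have hle : ∀ n, θ * ε n * e n t ≤ 1 := by
      intro n
      refine (le_abs_self _).trans ?_
      rw [abs_mul, abs_mul, hθ, hε, one_mul, one_mul]
      exact ((e n).norm_coe_le_norm t).trans (hnorm n).le
    have h0 := (hasSum_zero_iff_of_nonneg fun n =>
      mul_nonneg (by positivity) (sub_nonneg.2 (hle n))).1 hsum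
    have h1 : 1 / 2 / 2 ^ n * (1 - θ * ε n * e n t) = 0 := congr_fun h0 n
    have h2 : 1 - θ * ε n * e n t = 0 :=
      (mul_eq_zero.1 h1).resolve_left (by positivity)
    have h3 : (θ * ε n) * (θ * ε n) = 1 := by
      rw [← abs_mul_abs_self, abs_mul, hθ, hε]
      norm_num
    linear_combination (-(θ * ε n)) * h2 + e n t * (-h3)
  refine ⟨t, ?_⟩
  rcases eq_or_eq_neg_of_abs_eq ht with h | h
  · left
    intro n
    simpa using key 1 (by simp) (by rw [h]; norm_num) n
  · right
    intro n
    simpa using key (-1) (by simp) (by rw [h]; norm_num) n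

/-- The extension to the line of a continuous function on the interval is continuous. -/
theorem continuous_extCI (f : C(↥(Set.Icc (0 : ℝ) 1), ℝ)) : Continuous (extCI f) :=
  f.continuous.comp (Continuous.subtype_mk (by fun_prop) _)

theorem extCI_coe (f : C(↥(Set.Icc (0 : ℝ) 1), ℝ)) (t : ↥(Set.Icc (0 : ℝ) 1)) :
    extCI f t = f t := by
  have : min (max (t : ℝ) 0) 1 = t := by rw [max_eq_left t.2.1, min_eq_left t.2.2]
  simp only [extCI, this]

theorem htop_eq_top_of_forall_log_le {f : ℝ → ℝ}
    (h : ∀ m : ℕ, [NeZero m] → ENNReal.log m ≤ htop f) : htop f = ⊤ := by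
  have hlim : Filter.Tendsto (fun m : ℕ => ENNReal.log m) Filter.atTop (nhds ⊤) := by
    have := (ENNReal.continuous_log.tendsto ⊤).comp ENNReal.tendsto_nat_nhds_top
    rwa [ENNReal.log_top] at this
  refine top_le_iff.1 (le_of_tendsto hlim ?_)
  filter_upwards [Filter.eventually_ne_atTop 0] with m hm
  have : NeZero m := ⟨hm⟩
  exact h m

/-- Alternations at arbitrarily small positive heights `x` can be chosen successively, at heights
in `[lo d, η d)` with `η (d + 1)` at most `lo d / 2` and at most a radius `r` attached to the
functions already used. -/
theorem exists_nested_alternations {X : Type*} [LT X] {K : Set X} {x : X → ℝ} {e : ℕ → X → ℝ}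
    (h : ∀ η > 0, ∀ D : ℕ, ∃ n k s, D < k ∧
      IsAlternating {t | t ∈ K ∧ 0 < x t ∧ x t < η} (e n) k s)
    {r₀ : ℝ} (hr₀ : 0 < r₀) {r : ℕ → ℝ} (hr : ∀ n, 0 < r n) :
    ∃ (η lo : ℕ → ℝ) (n k : ℕ → ℕ) (s : ℕ → ℕ → X), η 0 = r₀ ∧
      (∀ d, η (d + 1) ≤ lo d / 2) ∧ (∀ d, η (d + 1) ≤ r (n d)) ∧ (∀ d, 0 < lo d) ∧
      (∀ d, lo d < η d) ∧ (∀ d, d < k d) ∧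
      ∀ d, IsAlternating {t | t ∈ K ∧ lo d ≤ x t ∧ x t < η d} (e (n d)) (k d) (s d) := by
  have h' : ∀ (η : ℝ) (D : ℕ), 0 < η → ∃ n k s lo, D < k ∧ 0 < lo ∧ lo < η ∧
      IsAlternating {t | t ∈ K ∧ lo ≤ x t ∧ x t < η} (e n) k s := by
    intro η D hη
    obtain ⟨n, k, s, hk, hs⟩ := h η hη D
    obtain ⟨i₀, hi₀, hmin⟩ := Finset.exists_min_image (Finset.range (k + 1)) (fun i => x (s i))
      ⟨0, by simp⟩
    have hi₀' := hs.1 i₀ (Nat.lt_succ_iff.1 (Finset.mem_range.1 hi₀))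
    refine ⟨n, k, s, x (s i₀), hk, hi₀'.2.1, hi₀'.2.2, fun i hi => ?_, hs.2⟩
    exact ⟨(hs.1 i hi).1, hmin i (Finset.mem_range.2 (Nat.lt_succ_iff.2 hi)), (hs.1 i hi).2.2⟩
  have : Nonempty X := by
    obtain ⟨-, -, s, -⟩ := h 1 one_pos 0
    exact ⟨s 0⟩
  choose! n k s lo hk hlo hlt hs using h'
  let η : ℕ → ℝ := fun d => Nat.rec r₀ (fun d y => min (lo y d / 2) (r (n y d))) d
  have hsucc : ∀ d, η (d + 1) = min (lo (η d) d / 2) (r (n (η d) d)) := fun _ => rfl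
  have hpos : ∀ d, 0 < η d := by
    intro d
    induction d with
    | zero => exact hr₀
    | succ d ih =>
      rw [hsucc]
      exact lt_min (half_pos (hlo _ d ih)) (hr _)
  exact ⟨η, fun d => lo (η d) d, fun d => n (η d) d, fun d => k (η d) d, fun d => s (η d) d, rfl,
    fun d => hsucc d ▸ min_le_left _ _, fun d => hsucc d ▸ min_le_right _ _,
    fun d => hlo _ d (hpos d), fun d => hlt _ d (hpos d), fun d => hk _ d (hpos d),
    fun d => hs _ d (hpos d)⟩

theorem eq_of_ne_of_abs_eq_one {a b c : ℝ} (ha : |a| = 1) (hb : |b| = 1) (hc : |c| = 1)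
    (hab : a ≠ b) (hac : a ≠ c) : b = c := by
  rcases eq_or_eq_neg_of_abs_eq ha with rfl | rfl <;>
    rcases eq_or_eq_neg_of_abs_eq hb with rfl | rfl <;>
    rcases eq_or_eq_neg_of_abs_eq hc with rfl | rfl <;> simp_all

theorem ell1_subspace_contains_infinite_entropy
    (A : Submodule ℝ C(↥(Set.Icc (0 : ℝ) 1), ℝ))
    (hclosed : IsClosed (A : Set C(↥(Set.Icc (0 : ℝ) 1), ℝ)))
    (hiso : Nonempty (A ≃ₗᵢ[ℝ] lp (fun _ : ℕ => ℝ) 1)) :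
    ∃ f ∈ A, htop (extCI f) = ⊤ := by
  obtain ⟨Φ⟩ := hiso
  obtain ⟨e, heA, henorm, hesign⟩ := exists_sign_functions A Φ
  obtain ⟨p, hp, σ, hσ, halt⟩ := exists_unbounded_alternation e hesign
  set K : Set ↥(Set.Icc (0 : ℝ) 1) := {t | ∀ n, |e n t| = 1}
  have hσσ : σ * σ = 1 := by rw [← abs_mul_abs_self, hσ, one_mul]
  have hdist : ∀ t : ↥(Set.Icc (0 : ℝ) 1), 0 < σ * (t - p : ℝ) →
      dist t p = σ * (t - p : ℝ) := by
    intro t ht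
    rw [Subtype.dist_eq, Real.dist_eq, ← abs_of_pos ht, abs_mul, hσ, one_mul]
  have hconst : ∀ n, ∃ r > 0, ∀ t ∈ K, dist t p < r → e n t = e n p := by
    intro n
    obtain ⟨r, hr, h⟩ := Metric.continuous_iff.1 (e n).continuous p 1 one_pos
    refine ⟨r, hr, fun t ht htp => ?_⟩
    have h1 := abs_lt.1 (h t htp)
    rcases eq_or_eq_neg_of_abs_eq (ht n) with h2 | h2 <;>
      rcases eq_or_eq_neg_of_abs_eq (hp n) with h3 | h3 <;> rw [h2, h3] at h1 ⊢ <;> norm_num at h1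
  choose r hr hrconst using hconst
  obtain ⟨η, lo, n, k, s, hη₀, hηlo, hηr, hlo, hloη, hk, hs⟩ :=
    exists_nested_alternations (K := K) (x := fun t => σ * (t - p : ℝ)) (e := fun n => e n)
      halt (hr 0) hr
  have hη : ∀ d, 0 < η d := fun d => (hlo d).trans (hloη d)
  have hη_half : ∀ d, η (d + 1) ≤ η d / 2 := fun d => by linarith [hηlo d, hloη d]
  have hη_geom : ∀ d j, η (d + 1 + j) ≤ lo d / 2 / 2 ^ j := by
    intro d j
    induction j with
    | zero => simpa using hηlo d
    | succ j ih =>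
      rw [pow_succ, ← div_div]
      have := hη_half (d + 1 + j)
      rw [add_assoc] at this
      linarith
  have hη_anti : Antitone η := antitone_nat_of_succ_le fun d => by linarith [hη_half d, hη d]
  have hη_sum : Summable η := by
    refine (summable_nat_add_iff 1).1 (Summable.of_nonneg_of_le (fun d => (hη _).le) (fun d => ?_)
      (summable_geometric_two' (lo 0)))
    simpa [add_comm] using hη_geom 0 d
  set G : ℕ → C(↥(Set.Icc (0 : ℝ) 1), ℝ) := fun d => e 0 p • e 0 - e (n d) p • e (n d) with hG
  set g : ℕ → C(↥(Set.Icc (0 : ℝ) 1), ℝ) := fun d => (σ * (η d / 2)) • G d with hg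
  have hgA : ∀ d, g d ∈ A := fun d =>
    A.smul_mem _ (A.sub_mem (A.smul_mem _ (heA _)) (A.smul_mem _ (heA _)))
  have hgsum : Summable g := by
    refine Summable.of_norm_bounded hη_sum fun d => ?_
    have h1 : ‖G d‖ ≤ 2 := by
      refine (norm_sub_le _ _).trans ?_
      simp only [norm_smul, Real.norm_eq_abs, hp, henorm]
      norm_num
    rw [norm_smul, Real.norm_eq_abs, abs_mul, hσ, one_mul, abs_of_pos (half_pos (hη d))]
    nlinarith [hη d]
  set f : C(↥(Set.Icc (0 : ℝ) 1), ℝ) := ((p : ℝ) * e 0 p) • e 0 + ∑' d, g d with hf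
  have hGK : ∀ t ∈ K, 0 < σ * (t - p : ℝ) → σ * (t - p : ℝ) < η 0 →
      ∀ d, G d t = 1 - e (n d) p * e (n d) t := by
    intro t ht h0 hlt d
    have h1 : e 0 t = e 0 p := hrconst 0 t ht (by rw [hdist t h0]; exact hη₀ ▸ hlt)
    have h2 : e 0 p * e 0 p = 1 := by rw [← abs_mul_abs_self, hp, one_mul]
    simp [hG, h1, h2]
  have hfK : ∀ t ∈ K, 0 < σ * (t - p : ℝ) → σ * (t - p : ℝ) < η 0 →
      HasSum (fun d => η d / 2 * G d t) (σ * (f t - p)) := by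
    intro t ht h0 hlt
    have h1 : e 0 t = e 0 p := hrconst 0 t ht (by rw [hdist t h0]; exact hη₀ ▸ hlt)
    have h2 : e 0 p * e 0 p = 1 := by rw [← abs_mul_abs_self, hp, one_mul]
    have h3 := ((ContinuousMap.evalCLM ℝ t).hasSum hgsum.hasSum).mul_left σ
    have h4 : f t - p = (∑' d, g d) t := by
      simp only [hf, ContinuousMap.add_apply, ContinuousMap.smul_apply, smul_eq_mul, h1]
      rw [mul_assoc, h2]
      ring
    rw [h4]
    refine h3.congr_fun fun d => ?_
    change η d / 2 * G d t = σ * (σ * (η d / 2) * G d t)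
    linear_combination (-(η d / 2 * G d t)) * hσσ
  have hG01 : ∀ t ∈ K, ∀ m, 1 - e m p * e m t = 0 ∨ 1 - e m p * e m t = 2 := by
    intro t ht m
    rcases eq_or_eq_neg_of_abs_eq (ht m) with h2 | h2 <;>
      rcases eq_or_eq_neg_of_abs_eq (hp m) with h3 | h3 <;> rw [h2, h3] <;> norm_num
  have hvals : ∀ d, ∀ t ∈ K, lo d ≤ σ * (t - p : ℝ) → σ * (t - p : ℝ) < η d →
      (e (n d) t = e (n d) p → σ * (f t - p) ≤ lo d) ∧
      (e (n d) t ≠ e (n d) p → η d ≤ σ * (f t - p)) := by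
    intro d t ht hlt hlt'
    have h0 := (hlo d).trans_le hlt
    have hlt₀ := hlt'.trans_le (hη_anti (Nat.zero_le d))
    have hsum := hfK t ht h0 hlt₀
    have hGt := hGK t ht h0 hlt₀
    have hnonneg : ∀ j, 0 ≤ η j / 2 * G j t := by
      intro j
      rw [hGt]
      rcases hG01 t ht (n j) with h | h <;> rw [h] <;> linarith [hη j]
    refine ⟨fun heq => ?_, fun hne => ?_⟩
    · have hzero : ∀ j ∈ Finset.range (d + 1), η j / 2 * G j t = 0 := by
        intro j hj
        have : e (n j) t = e (n j) p := by
          rcases (Nat.lt_succ_iff.1 (Finset.mem_range.1 hj)).eq_or_lt with rfl | hj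
          · exact heq
          · refine hrconst _ t ht ?_
            rw [hdist t h0]
            exact hlt'.trans_le ((hη_anti hj).trans (hηr j))
        rw [hGt, this, ← abs_mul_abs_self, hp]
        norm_num
      have htail := (hasSum_nat_add_iff' (d + 1)).2 hsum
      rw [Finset.sum_eq_zero hzero, sub_zero] at htail
      refine hasSum_le (fun j => ?_) htail (hasSum_geometric_two' (lo d))
      refine le_trans ?_ (hη_geom d j)
      rw [hGt, add_comm j]
      rcases hG01 t ht (n (d + 1 + j)) with h | h <;> rw [h] <;> linarith [hη (d + 1 + j)]
    · refine le_trans (le_of_eq ?_) (le_hasSum hsum d fun j _ => hnonneg j)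
      rw [hGt]
      rcases hG01 t ht (n d) with h | h
      · refine absurd ?_ hne
        have : e (n d) p * e (n d) p = 1 := by rw [← abs_mul_abs_self, hp, one_mul]
        linear_combination (-e (n d) p) * h - e (n d) t * this
      · rw [h]
        ring
  refine ⟨f, A.add_mem (A.smul_mem _ (heA 0)) (tsum_mem hclosed hgA),
    htop_eq_top_of_forall_log_le fun m _ => ?_⟩
  obtain ⟨hmem, hstep⟩ := hs (2 * m)
  have hsK := fun i hi => (hmem i hi).1
  have hv := fun i hi => hvals (2 * m) (s (2 * m) i) (hmem i hi).1 (hmem i hi).2.1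
    (hmem i hi).2.2
  have hy : ∀ i < k (2 * m),
      σ * (f (s (2 * m) i) - p) ≤ lo (2 * m) ∧ η (2 * m) ≤ σ * (f (s (2 * m) (i + 1)) - p) ∨
      η (2 * m) ≤ σ * (f (s (2 * m) i) - p) ∧ σ * (f (s (2 * m) (i + 1)) - p) ≤ lo (2 * m) := by
    intro i hi
    have hne := (hstep i hi).2
    by_cases h1 : e (n (2 * m)) (s (2 * m) i) = e (n (2 * m)) p
    · exact .inl ⟨(hv i hi.le).1 h1, (hv (i + 1) hi).2 fun h2 => hne (h1.trans h2.symm)⟩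
    · refine .inr ⟨(hv i hi.le).2 h1, (hv (i + 1) hi).1 ?_⟩
      exact eq_of_ne_of_abs_eq_one (hsK i hi.le _) (hsK (i + 1) hi _) (hp _) hne h1
  have hkm := hk (2 * m)
  rcases eq_or_eq_neg_of_abs_eq hσ with rfl | rfl
  · refine log_le_htop_of_alternating (continuous_extCI f) (u := p + lo (2 * m))
      (v := p + η (2 * m)) (k := k (2 * m)) (by omega) (s := fun i => s (2 * m) i)
      (fun i hi => (hstep i hi).1) (fun i hi => ?_) (fun i hi => ?_)
    · obtain ⟨-, h1, h2⟩ := hmem i hi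
      constructor <;> linarith
    · simp only [extCI_coe]
      rcases hy i hi with h | h
      · exact .inl ⟨by linarith [h.1], by linarith [h.2]⟩
      · exact .inr ⟨by linarith [h.1], by linarith [h.2]⟩
  · refine log_le_htop_of_alternating (continuous_extCI f) (u := p - η (2 * m))
      (v := p - lo (2 * m)) (k := k (2 * m)) (by omega) (s := fun i => s (2 * m) i)
      (fun i hi => (hstep i hi).1) (fun i hi => ?_) (fun i hi => ?_)
    · obtain ⟨-, h1, h2⟩ := hmem i hi
      constructor <;> linarith
    · simp only [extCI_coe]
      rcases hy i hi with h | h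
      · exact .inr ⟨by linarith [h.1], by linarith [h.2]⟩
      · exact .inl ⟨by linarith [h.1], by linarith [h.2]⟩
end

section
/- There exists a closed separable linear subspace A of the Banach space of bounded continuous functions ℝ → ℝ (with the supremum norm) such that: (i) A is universal, i.e. every real separable Banach space is isometrically isomorphic to a closed linear subspace of A; and (ii) every nonzero f ∈ A has infinite topological entropy, h_top(f) = ∞. -/
open BoundedContinuousFunction

section

open Dynamics Set Real

lemma exists_itinerary {X : Type*} {T : X → X} {ι : Type*} {I : ι → Set X}
    (hne : ∀ i, (I i).Nonempty) (hcov : ∀ i j, I j ⊆ T '' I i) (n : ℕ) (w : ℕ → ι) :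
    ∃ x, ∀ k ≤ n, T^[k] x ∈ I (w k) := by
  induction n generalizing w with
  | zero =>
    obtain ⟨x, hx⟩ := hne (w 0)
    exact ⟨x, fun k hk => by obtain rfl := Nat.le_zero.mp hk; exact hx⟩
  | succ n ih =>
    obtain ⟨y, hy⟩ := ih fun k => w (k + 1)
    obtain ⟨x, hx, rfl⟩ := hcov (w 0) (w 1) (hy 0 n.zero_le)
    refine ⟨x, fun k hk => ?_⟩
    cases k with
    | zero => exact hx
    | succ k => exact hy k (by omega)

lemma log_card_le_coverEntropy {X : Type*} [PseudoMetricSpace X] {T : X → X} {F : Set X}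
    {d : ℕ} {I : Fin d → Set X} {ε : ℝ} (hd : 0 < d) (hε : 0 < ε)
    (hsep : ∀ i j, i ≠ j → ∀ x ∈ I i, ∀ y ∈ I j, ε ≤ dist x y)
    (hne : ∀ i, (I i).Nonempty) (hcov : ∀ i j, I j ⊆ T '' I i) (hF : ∀ i, I i ⊆ F) :
    ENNReal.log d ≤ coverEntropy T F := by
  classical
  set U : SetRel X X := {p | dist p.1 p.2 < ε / 2} with hU
  refine le_trans ?_ (netEntropyEntourage_le_coverEntropy (U := U) T F
    (Metric.dist_mem_uniformity (half_pos hε)))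
  rw [← ExpGrowth.expGrowthSup_pow]
  refine ExpGrowth.expGrowthSup_eventually_monotone (Filter.eventually_atTop.2 ⟨1, fun n hn => ?_⟩)
  have hx (w : Fin n → Fin d) : ∃ x, ∀ k : Fin n, T^[k] x ∈ I (w k) := by
    obtain ⟨x, hx⟩ := exists_itinerary hne hcov n
      fun k => if h : k < n then w ⟨k, h⟩ else ⟨0, hd⟩
    exact ⟨x, fun k => by simpa using hx k k.2.le⟩
  choose x hx using hx
  have key {v w : Fin n → Fin d} {z : X} (hv : z ∈ UniformSpace.ball (x v) (dynEntourage T U n))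
      (hw : z ∈ UniformSpace.ball (x w) (dynEntourage T U n)) : v = w := by
    rw [mem_ball_dynEntourage] at hv hw
    by_contra h
    obtain ⟨k, hk⟩ := Function.ne_iff.1 h
    have h1 : dist (T^[k] (x v)) (T^[k] z) < ε / 2 := hv k k.2
    have h2 : dist (T^[k] (x w)) (T^[k] z) < ε / 2 := hw k k.2
    have h3 := hsep _ _ hk _ (hx v k) _ (hx w k)
    have h4 := dist_triangle_right (T^[k] (x v)) (T^[k] (x w)) (T^[k] z)
    linarith
  have hself (w : Fin n → Fin d) : x w ∈ UniformSpace.ball (x w) (dynEntourage T U n) := by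
    rw [mem_ball_dynEntourage]
    intro k _
    simp [UniformSpace.ball, hU, half_pos hε]
  have hinj : Function.Injective x := fun v w h => key (hself v) (h ▸ hself w)
  have hnet : IsDynNetIn T F U n (Finset.univ.image x : Finset X) := by
    refine ⟨?_, ?_⟩
    · simp only [Finset.coe_image, Finset.coe_univ, image_univ]
      rintro _ ⟨w, rfl⟩
      exact hF _ (hx w ⟨0, hn⟩)
    · simp only [Finset.coe_image, Finset.coe_univ, image_univ]
      rintro _ ⟨v, rfl⟩ _ ⟨w, rfl⟩ h
      exact disjoint_left.2 fun z hv hw => h (congrArg x (key hv hw))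
  have hcard := hnet.card_le_netMaxcard
  rw [Finset.card_image_of_injective _ hinj] at hcard
  simpa using ENat.toENNReal_mono hcard

/-- **Banach–Mazur theorem** for continuous functions on the Cantor space. -/
theorem exists_linearIsometry_continuousMap_cantor (B : Type*) [NormedAddCommGroup B]
    [NormedSpace ℝ B] [TopologicalSpace.SeparableSpace B] :
    Nonempty (B →ₗᵢ[ℝ] C(ℕ → Bool, ℝ)) := by
  let K : Set (WeakDual ℝ B) := WeakDual.toStrongDual ⁻¹' Metric.closedBall 0 1
  have hK : IsCompact K := WeakDual.isCompact_closedBall (𝕜 := ℝ) 0 1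
  have : CompactSpace K := isCompact_iff_compactSpace.mp hK
  have : TopologicalSpace.MetrizableSpace K := WeakDual.metrizable_of_isCompact ℝ B K hK
  let : MetricSpace K := TopologicalSpace.metrizableSpaceMetric K
  have : Nonempty K := ⟨⟨0, by simp [K]⟩⟩
  obtain ⟨p, hp, hps⟩ := exists_nat_bool_continuous_surjective_of_compact K
  let L : B →ₗ[ℝ] C(ℕ → Bool, ℝ) :=
    { toFun := fun b => ⟨fun t => (p t : WeakDual ℝ B) b,
        (WeakDual.eval_continuous b).comp (continuous_subtype_val.comp hp)⟩
      map_add' := fun a b => by ext t; exact map_add (p t : WeakDual ℝ B) a b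
      map_smul' := fun r b => by ext t; exact map_smul (p t : WeakDual ℝ B) r b }
  refine ⟨⟨L, fun b => le_antisymm ?_ ?_⟩⟩
  · refine (ContinuousMap.norm_le _ (norm_nonneg b)).2 fun t => ?_
    have h : ‖WeakDual.toStrongDual (p t : WeakDual ℝ B)‖ ≤ 1 :=
      mem_closedBall_zero_iff.1 (p t).2
    exact (WeakDual.toStrongDual (p t : WeakDual ℝ B)).le_of_opNorm_le h b |>.trans (by simp)
  · obtain ⟨g, hg, hgb⟩ := exists_dual_vector'' ℝ b
    obtain ⟨t, ht⟩ := hps ⟨StrongDual.toWeakDual g, by simpa [K] using hg⟩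
    have h := (L b).norm_coe_le_norm t
    have h2 : L b t = ‖b‖ := by
      change (p t : WeakDual ℝ B) b = ‖b‖
      rw [ht]; exact hgb
    rw [h2] at h
    simpa using h

/-- On `[n, n + 1)`, this is `c n` times a sine wave making `n` full oscillations. -/
noncomputable def osc (c : ℤ → ℝ) (y : ℝ) : ℝ := c ⌊y⌋ * sin (2 * π * ⌊y⌋ * y)

lemma osc_eq (c : ℤ → ℝ) {n : ℤ} {y : ℝ} (hy : y ∈ Icc (n : ℝ) (n + 1)) :
    osc c y = c n * sin (2 * π * n * y) := by
  rcases hy.2.lt_or_eq with h | rfl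
  · rw [osc, Int.floor_eq_iff.2 ⟨hy.1, h⟩]
  · have h1 : sin (2 * π * n * (n + 1)) = 0 := by
      rw [show 2 * π * n * (n + 1) = ((2 * n * (n + 1) : ℤ) : ℝ) * π by push_cast; ring]
      exact sin_int_mul_pi _
    have h2 : sin (2 * π * (n + 1) * (n + 1)) = 0 := by
      rw [show 2 * π * (n + 1) * (n + 1) = ((2 * (n + 1) * (n + 1) : ℤ) : ℝ) * π by
        push_cast; ring]
      exact sin_int_mul_pi _
    have h3 : ⌊(n : ℝ) + 1⌋ = n + 1 := by simp
    rw [osc, h3]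
    push_cast
    rw [h1, h2, mul_zero, mul_zero]

lemma osc_eq_zero (c : ℤ → ℝ) {y : ℝ} (hy : y ∈ Icc (0 : ℝ) 1) : osc c y = 0 := by
  rw [osc_eq c (n := 0) (by simpa using hy)]
  simp

lemma continuous_osc (c : ℤ → ℝ) : Continuous (osc c) := by
  have hlf : LocallyFinite fun n : ℤ => Icc (n : ℝ) (n + 1) :=
    locallyFinite_Icc_of_tendsto
      (by simpa using tendsto_intCast_atTop_atTop (R := ℝ))
      (Filter.tendsto_atBot_add_const_right _ 1 (tendsto_intCast_atBot_iff.2 Filter.tendsto_id))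
  refine hlf.continuous (iUnion_Icc_intCast ℝ) (fun _ => isClosed_Icc) fun n => ?_
  exact ContinuousOn.congr (by fun_prop) fun y hy => osc_eq c hy

lemma abs_osc_le {c : ℤ → ℝ} {M : ℝ} (hc : ∀ n, |c n| ≤ M) (y : ℝ) : |osc c y| ≤ M := by
  rw [osc, abs_mul]
  have h1 := hc ⌊y⌋
  have h2 := abs_sin_le_one (2 * π * ⌊y⌋ * y)
  nlinarith [abs_nonneg (c ⌊y⌋)]

lemma exists_osc_eq (c : ℤ → ℝ) {n : ℤ} (hn : n < 0) : ∃ y < 0, osc c y = c n := by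
  have hn' : (n : ℝ) ≤ -1 := by exact_mod_cast Int.le_sub_one_of_lt hn
  have h0 : (n : ℝ) ≠ 0 := by linarith
  have h1 : 1 / (4 * (n : ℝ)) < 0 := by
    apply div_neg_of_pos_of_neg <;> linarith
  have h2 : -1 ≤ 1 / (4 * (n : ℝ)) := by
    rw [le_div_iff_of_neg] <;> linarith
  refine ⟨(n + 1) + 1 / (4 * n), by linarith, ?_⟩
  rw [osc_eq c (n := n) ⟨by linarith, by linarith⟩,
    show 2 * π * n * ((n + 1) + 1 / (4 * n)) = π / 2 + ((n * (n + 1) : ℤ) : ℝ) * (2 * π) by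
      push_cast; field_simp; ring, sin_add_int_mul_two_pi, sin_pi_div_two, mul_one]

/-- Rapid oscillations accumulating at `0` on the positive half-line, with amplitudes decaying
slower than the distance to `0`; undamped oscillations on the negative half-line. -/
noncomputable def doubleOsc (c : ℤ → ℝ) (x : ℝ) : ℝ := osc c (min x 0) + √x * osc c x⁻¹

lemma doubleOsc_of_nonpos (c : ℤ → ℝ) {x : ℝ} (hx : x ≤ 0) : doubleOsc c x = osc c x := by
  simp [doubleOsc, min_eq_left hx, sqrt_eq_zero_of_nonpos hx]

lemma doubleOsc_of_nonneg (c : ℤ → ℝ) {x : ℝ} (hx : 0 ≤ x) :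
    doubleOsc c x = √x * osc c x⁻¹ := by
  simp [doubleOsc, min_eq_right hx, osc_eq_zero]

lemma abs_doubleOsc_le {c : ℤ → ℝ} {M : ℝ} (hc : ∀ n, |c n| ≤ M) (x : ℝ) :
    |doubleOsc c x| ≤ M := by
  rcases le_total x 0 with hx | hx
  · rw [doubleOsc_of_nonpos c hx]
    exact abs_osc_le hc x
  rw [doubleOsc_of_nonneg c hx]
  have h := abs_osc_le hc x⁻¹
  rcases le_total x 1 with hx1 | hx1
  · rw [abs_mul, abs_of_nonneg (sqrt_nonneg x)]
    have := sqrt_le_one.2 hx1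
    nlinarith [abs_nonneg (osc c x⁻¹), sqrt_nonneg x]
  · rw [osc_eq_zero c ⟨inv_nonneg.2 hx, inv_le_one_of_one_le₀ hx1⟩, mul_zero, abs_zero]
    exact (abs_nonneg _).trans h

lemma continuous_doubleOsc {c : ℤ → ℝ} {M : ℝ} (hc : ∀ n, |c n| ≤ M) :
    Continuous (doubleOsc c) := by
  refine ((continuous_osc c).comp (continuous_id.min continuous_const)).add ?_
  refine continuous_iff_continuousAt.2 fun x => ?_
  rcases eq_or_ne x 0 with rfl | hx
  · have h : Filter.Tendsto (fun x : ℝ => √x * osc c x⁻¹) (nhds 0) (nhds 0) := by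
      refine Filter.Tendsto.zero_mul_isBoundedUnder_le ?_ ?_
      · simpa using (continuous_sqrt.tendsto 0)
      · exact Filter.isBoundedUnder_of ⟨M, fun x => abs_osc_le hc x⁻¹⟩
    simpa [ContinuousAt] using h
  · exact continuous_sqrt.continuousAt.mul
      ((continuous_osc c).continuousAt.comp (continuousAt_inv₀ hx))

lemma doubleOsc_inv (c : ℤ → ℝ) {n : ℤ} {y : ℝ} (hy : y ∈ Icc (n : ℝ) (n + 1)) (hy0 : 0 ≤ y) :
    doubleOsc c y⁻¹ = √y⁻¹ * (c n * sin (2 * π * n * y)) := by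
  rw [doubleOsc_of_nonneg c (inv_nonneg.2 hy0), inv_inv, osc_eq c hy]

lemma sqrt_inv_mul_abs_ge {n y a : ℝ} (hn : 1 ≤ n) (hy : 0 < y) (hyn : y ≤ n + 1)
    (ha : 2 ≤ n * a ^ 2) : n⁻¹ ≤ √y⁻¹ * |a| := by
  refine abs_le_of_sq_le_sq' ?_ (by positivity) |>.2
  rw [mul_pow, sq_sqrt (by positivity), sq_abs, inv_pow, inv_mul_eq_div,
    inv_le_comm₀ (by positivity) (by apply div_pos _ hy; nlinarith), inv_div,
    div_le_iff₀ (by nlinarith)]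
  nlinarith

/-- The `j`-th lap interval: half of an oscillation of `doubleOsc c`, from a maximum of the sine
factor to the following minimum, inside `[1 / (n + 1), 1 / n]`. -/
noncomputable def lapInterval (n : ℕ) (j : ℕ) : Set ℝ :=
  Icc (n + (j + 3 / 4) / n : ℝ)⁻¹ (n + (j + 1 / 4) / n : ℝ)⁻¹

lemma lapInterval_endpoint_mem {n j : ℕ} (hj : j < n) {r : ℝ} (hr : r ∈ Ioo (0 : ℝ) 1) :
    (n + (j + r) / n : ℝ) ∈ Icc (n : ℝ) (n + 1) := by
  have hj' : (j : ℝ) + 1 ≤ n := by exact_mod_cast hj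
  have hj0 : (0 : ℝ) ≤ j := j.cast_nonneg
  have hn : (0 : ℝ) < n := by linarith
  have h0 := hr.1
  have h1 : ((j : ℝ) + r) / n ≤ 1 := by rw [div_le_one hn]; linarith [hr.2]
  have h2 : 0 ≤ ((j : ℝ) + r) / n := by positivity
  exact ⟨by linarith, by linarith⟩

lemma lapInterval_endpoints_le {n j : ℕ} (hj : j < n) :
    (n + (j + 3 / 4) / n : ℝ)⁻¹ ≤ (n + (j + 1 / 4) / n : ℝ)⁻¹ := by
  have hn : (0 : ℝ) < n := by exact_mod_cast (Nat.zero_le j).trans_lt hj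
  gcongr
  norm_num

lemma lapInterval_subset {n j : ℕ} (hj : j < n) : lapInterval n j ⊆ Icc (n + 1 : ℝ)⁻¹ (n : ℝ)⁻¹ := by
  have hn : (0 : ℝ) < n := by exact_mod_cast (Nat.zero_le j).trans_lt hj
  have h1 := lapInterval_endpoint_mem hj (r := 1 / 4) (by norm_num)
  have h3 := lapInterval_endpoint_mem hj (r := 3 / 4) (by norm_num)
  exact Icc_subset_Icc (inv_anti₀ (hn.trans_le h3.1) h3.2) (inv_anti₀ hn h1.1)

lemma lapInterval_separated_of_lt {n i j : ℕ} (hi : i < j) (hj : j < n) {x y : ℝ}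
    (hx : x ∈ lapInterval n i) (hy : y ∈ lapInterval n j) :
    (n + 1 : ℝ)⁻¹ ^ 2 * (2 * n : ℝ)⁻¹ ≤ dist x y := by
  have hn : (0 : ℝ) < n := by exact_mod_cast (Nat.zero_le j).trans_lt hj
  have hx' := (lapInterval_subset (hi.trans hj) hx).1
  have hy' := (lapInterval_subset hj hy).1
  have hp : (0 : ℝ) < (n + 1 : ℝ)⁻¹ := by positivity
  have hx0 := hp.trans_le hx'
  have hy0 := hp.trans_le hy'
  have h1 : x⁻¹ ≤ n + (i + 3 / 4) / n := by
    rw [inv_le_comm₀ hx0 (by positivity)]; exact hx.1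
  have h2 : n + (j + 1 / 4) / n ≤ y⁻¹ := by
    rw [le_inv_comm₀ (by positivity) hy0]; exact hy.2
  have hij : (i : ℝ) + 1 ≤ j := by exact_mod_cast hi
  have h3 : ((i : ℝ) + 3 / 4) / n + (2 * n : ℝ)⁻¹ ≤ (j + 1 / 4) / n := by
    rw [mul_inv, ← div_eq_mul_inv, ← add_div]
    exact div_le_div_of_nonneg_right (by linarith) hn.le
  have h4 : (2 * n : ℝ)⁻¹ ≤ y⁻¹ - x⁻¹ := by linarith
  calc (n + 1 : ℝ)⁻¹ ^ 2 * (2 * n : ℝ)⁻¹ ≤ (x * y) * (y⁻¹ - x⁻¹) := by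
        rw [pow_two]
        gcongr
    _ = x - y := by field_simp
    _ ≤ dist x y := le_abs_self _

lemma lapInterval_separated {n i j : ℕ} (hij : i ≠ j) (hi : i < n) (hj : j < n) {x y : ℝ}
    (hx : x ∈ lapInterval n i) (hy : y ∈ lapInterval n j) :
    (n + 1 : ℝ)⁻¹ ^ 2 * (2 * n : ℝ)⁻¹ ≤ dist x y := by
  rcases hij.lt_or_gt with h | h
  · exact lapInterval_separated_of_lt h hj hx hy
  · rw [dist_comm]
    exact lapInterval_separated_of_lt h hi hy hx

lemma Icc_subset_image_lapInterval {c : ℤ → ℝ} {n j : ℕ} (hcont : Continuous (doubleOsc c)) (hj : j < n)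
    (hc : 2 ≤ n * c n ^ 2) : Icc 0 (n : ℝ)⁻¹ ⊆ doubleOsc c '' lapInterval n j := by
  have hn1 : (1 : ℝ) ≤ n := by exact_mod_cast (Nat.zero_le j).trans_lt hj
  have hn : (0 : ℝ) < n := by linarith
  have h1 := lapInterval_endpoint_mem hj (r := 1 / 4) (by norm_num)
  have h3 := lapInterval_endpoint_mem hj (r := 3 / 4) (by norm_num)
  have e1 := doubleOsc_inv c (n := n) (by simpa using h1) (hn.le.trans h1.1)
  have e3 := doubleOsc_inv c (n := n) (by simpa using h3) (hn.le.trans h3.1)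
  have g1 := sqrt_inv_mul_abs_ge hn1 (hn.trans_le h1.1) h1.2 hc
  have g3 := sqrt_inv_mul_abs_ge hn1 (hn.trans_le h3.1) h3.2 hc
  have hs (r : ℝ) : sin (2 * π * (n : ℤ) * (n + (j + r) / n)) = sin (2 * π * r) := by
    rw [show 2 * π * (n : ℤ) * (n + (j + r) / n) = 2 * π * r + ((n ^ 2 + j : ℕ) : ℝ) * (2 * π) by
      push_cast; field_simp; ring, sin_add_nat_mul_two_pi]
  rw [hs, show 2 * π * (1 / 4) = π / 2 by ring, sin_pi_div_two, mul_one] at e1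
  rw [hs, show 2 * π * (3 / 4) = π / 2 + π by ring, sin_add_pi, sin_pi_div_two, mul_neg_one,
    mul_neg] at e3
  have hivt := intermediate_value_uIcc (f := doubleOsc c) (a := (n + (j + 3 / 4) / n : ℝ)⁻¹)
    (b := (n + (j + 1 / 4) / n : ℝ)⁻¹) hcont.continuousOn
  rw [uIcc_of_le (lapInterval_endpoints_le hj), e1, e3] at hivt
  refine Subset.trans (fun t ht => ?_) hivt
  rcases abs_cases (c n) with ⟨h, -⟩ | ⟨h, -⟩ <;> rw [h] at g1 g3 <;>
    have hinv : 0 < (n : ℝ)⁻¹ := inv_pos.2 hn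
  · exact mem_uIcc.2 (Or.inl ⟨by linarith [ht.1], by linarith [ht.2]⟩)
  · exact mem_uIcc.2 (Or.inr ⟨by linarith [ht.1], by linarith [ht.2]⟩)

lemma log_le_htop_doubleOsc {c : ℤ → ℝ} {n : ℕ} (hcont : Continuous (doubleOsc c)) (hn : 0 < n)
    (hc : 2 ≤ n * c n ^ 2) : ENNReal.log n ≤ htop (doubleOsc c) := by
  have hcov (i j : Fin n) : lapInterval n j ⊆ doubleOsc c '' lapInterval n i :=
    (lapInterval_subset j.2).trans <| (Icc_subset_Icc_left (by positivity)).trans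
      (Icc_subset_image_lapInterval hcont i.2 hc)
  exact log_card_le_coverEntropy (I := fun j : Fin n => lapInterval n j) hn
    (ε := (n + 1 : ℝ)⁻¹ ^ 2 * (2 * n : ℝ)⁻¹) (by positivity)
    (fun i j hij x hx y hy => lapInterval_separated (Fin.val_ne_of_ne hij) i.2 j.2 hx hy)
    (fun i => nonempty_Icc.2 (lapInterval_endpoints_le i.2)) hcov
    (fun i => (hcov i i).trans <| (image_subset_range _ _).trans subset_closure)

lemma htop_doubleOsc_eq_top {c : ℤ → ℝ} {a : ℝ} (hcont : Continuous (doubleOsc c)) (ha : a ≠ 0)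
    (hfreq : ∃ᶠ n : ℕ in Filter.atTop, c n = a) : htop (doubleOsc c) = ⊤ := by
  have ha2 : 0 < a ^ 2 := by positivity
  obtain ⟨y, hy⟩ := ENNReal.log_surjective (htop (doubleOsc c))
  rw [← hy, ENNReal.log_eq_top_iff]
  by_contra hytop
  obtain ⟨N, hN⟩ := ENNReal.exists_nat_gt hytop
  obtain ⟨M, hM⟩ := exists_nat_ge (2 / a ^ 2)
  obtain ⟨n, hn, hna⟩ := Filter.frequently_atTop.1 hfreq (max (N + 1) M)
  have hn1 : N + 1 ≤ n := (le_max_left _ _).trans hn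
  have hnM : (M : ℝ) ≤ n := by exact_mod_cast (le_max_right _ _).trans hn
  have hle := log_le_htop_doubleOsc (n := n) hcont (by omega) (by
    rw [hna]
    exact (div_le_iff₀ ha2).1 (hM.trans hnM))
  rw [← hy, ENNReal.log_le_log_iff] at hle
  have hNn : (N : ENNReal) ≤ n := by exact_mod_cast (by omega : N ≤ n)
  exact (hN.trans_le (hNn.trans hle)).false

/-- A dense sequence in the Cantor space, with each term repeated infinitely often along the
positive and along the negative integers. -/
noncomputable def cantorSeq (n : ℤ) : ℕ → Bool :=
  TopologicalSpace.denseSeq (ℕ → Bool) n.natAbs.unpair.1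

lemma exists_cantorSeq_eq (k N : ℕ) :
    ∃ n : ℕ, N ≤ n ∧ ∀ m : ℤ, m.natAbs = n → cantorSeq m = TopologicalSpace.denseSeq _ k :=
  ⟨Nat.pair k N, Nat.right_le_pair k N, fun m hm => by simp [cantorSeq, hm]⟩

lemma abs_apply_cantorSeq_le (f : C(ℕ → Bool, ℝ)) (n : ℤ) : |f (cantorSeq n)| ≤ ‖f‖ :=
  f.norm_coe_le_norm _

/-- The isometric embedding of `C(ℕ → Bool, ℝ)` into bounded continuous functions on `ℝ` given by
the oscillating functions whose amplitudes are the values along `cantorSeq`. -/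
noncomputable def oscillationIsometry : C(ℕ → Bool, ℝ) →ₗᵢ[ℝ] (ℝ →ᵇ ℝ) where
  toFun f := BoundedContinuousFunction.ofNormedAddCommGroup (doubleOsc fun n => f (cantorSeq n))
    (continuous_doubleOsc (abs_apply_cantorSeq_le f)) ‖f‖
    (abs_doubleOsc_le (abs_apply_cantorSeq_le f))
  map_add' f g := by
    ext x
    simp [doubleOsc, osc]
    ring
  map_smul' r f := by
    ext x
    simp [doubleOsc, osc]
    ring
  norm_map' f := by
    refine le_antisymm (BoundedContinuousFunction.norm_ofNormedAddCommGroup_le _ (norm_nonneg f)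
      (abs_doubleOsc_le (abs_apply_cantorSeq_le f))) ?_
    refine (ContinuousMap.norm_le _ (norm_nonneg _)).2 ?_
    intro t
    set g := BoundedContinuousFunction.ofNormedAddCommGroup (doubleOsc fun n => f (cantorSeq n))
      (continuous_doubleOsc (abs_apply_cantorSeq_le f)) ‖f‖
      (abs_doubleOsc_le (abs_apply_cantorSeq_le f)) with hg
    refine (TopologicalSpace.denseRange_denseSeq (ℕ → Bool)).induction_on
      (p := fun t => ‖f t‖ ≤ ‖g‖) t
      (isClosed_le f.continuous.norm continuous_const) fun k => ?_
    obtain ⟨n, hn, h⟩ := exists_cantorSeq_eq k 1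
    obtain ⟨y, hy, hy'⟩ := exists_osc_eq (fun n => f (cantorSeq n)) (n := -n) (by omega)
    have hgy : g y = f (TopologicalSpace.denseSeq _ k) := by
      rw [← h (-n) (by simp), ← hy', ← doubleOsc_of_nonpos _ hy.le]
      rfl
    exact hgy ▸ g.norm_coe_le_norm y

lemma htop_oscillationIsometry_eq_top {f : C(ℕ → Bool, ℝ)} (hf : f ≠ 0) :
    htop (oscillationIsometry f) = ⊤ := by
  obtain ⟨k, hk⟩ : ∃ k, f (TopologicalSpace.denseSeq _ k) ≠ 0 := by
    by_contra! h
    refine hf (DFunLike.coe_injective ?_)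
    exact f.continuous.ext_on (TopologicalSpace.denseRange_denseSeq _) continuous_const
      (by rintro _ ⟨k, rfl⟩; exact h k)
  refine htop_doubleOsc_eq_top (continuous_doubleOsc (abs_apply_cantorSeq_le f)) hk ?_
  refine Filter.frequently_atTop.2 fun N => ?_
  obtain ⟨n, hn, h⟩ := exists_cantorSeq_eq k N
  exact ⟨n, hn, congrArg f (h n (by simp))⟩

end

theorem exists_universal_space_infinite_entropy :
    ∃ A : Submodule ℝ (ℝ →ᵇ ℝ),
      IsClosed (A : Set (ℝ →ᵇ ℝ)) ∧
      TopologicalSpace.SeparableSpace A ∧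
      (∀ (B : Type) [NormedAddCommGroup B] [NormedSpace ℝ B] [CompleteSpace B]
          [TopologicalSpace.SeparableSpace B],
        ∃ C : Submodule ℝ (ℝ →ᵇ ℝ), C ≤ A ∧ IsClosed (C : Set (ℝ →ᵇ ℝ)) ∧
          Nonempty (B ≃ₗᵢ[ℝ] C)) ∧
      (∀ f ∈ A, f ≠ 0 → htop f = ⊤) := by
  refine ⟨LinearMap.range oscillationIsometry.toLinearMap, ?_, ?_, ?_, ?_⟩
  · exact oscillationIsometry.isometry.isClosedEmbedding.isClosed_range
  · exact oscillationIsometry.equivRange.surjective.denseRange.separableSpace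
      oscillationIsometry.equivRange.continuous
  · intro B _ _ _ _
    obtain ⟨L⟩ := exists_linearIsometry_continuousMap_cantor B
    refine ⟨LinearMap.range (oscillationIsometry.comp L).toLinearMap, ?_, ?_,
      ⟨(oscillationIsometry.comp L).equivRange⟩⟩
    · rintro _ ⟨b, rfl⟩
      exact ⟨L b, rfl⟩
    · exact (oscillationIsometry.comp L).isometry.isClosedEmbedding.isClosed_range
  · rintro _ ⟨f, rfl⟩ hf
    exact htop_oscillationIsometry_eq_top fun h => hf (by simp [h])
end

section
/- For every t ∈ [0, ∞] (an extended nonnegative real) there exists a bounded continuous function f : ℝ → ℝ such that h_top(λ·f) = t for every real λ ≠ 0; equivalently, the one-dimensional subspace B = {λ·f : λ ∈ ℝ} satisfies h_top^−(B) = h_top^+(B) = t. -/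
open BoundedContinuousFunction

open Set Filter Topology Dynamics MeasureTheory

/-- At every point, on either side, `G` is locally affine with slope `σ` or `-σ`. -/
def HasSlopes (σ : ℝ) (G : ℝ → ℝ) : Prop :=
  ∀ x e : ℝ, |e| = 1 → ∃ e' : ℝ, |e'| = 1 ∧
    ∀ᶠ h in 𝓝[≥] (0 : ℝ), G (x + e * h) = G x + e' * (σ * h)

theorem HasSlopes.comp {σ τ : ℝ} {G H : ℝ → ℝ} (hσ : 0 ≤ σ) (hH : HasSlopes τ H)
    (hG : HasSlopes σ G) : HasSlopes (τ * σ) (H ∘ G) := by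
  intro x e he
  obtain ⟨e₁, he₁, h₁⟩ := hG x e he
  obtain ⟨e₂, he₂, h₂⟩ := hH (G x) e₁ he₁
  refine ⟨e₂, he₂, ?_⟩
  have ht : Tendsto (fun h : ℝ => σ * h) (𝓝[≥] 0) (𝓝[≥] 0) := by
    refine tendsto_nhdsWithin_iff.2 ⟨?_, ?_⟩
    · have : Tendsto (fun h : ℝ => σ * h) (𝓝 0) (𝓝 (σ * 0)) := by
        exact (continuous_const.mul continuous_id).tendsto 0
      rw [mul_zero] at this
      exact this.mono_left nhdsWithin_le_nhds
    · filter_upwards [self_mem_nhdsWithin] with h hh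
      exact mul_nonneg hσ hh
  filter_upwards [h₁, ht.eventually h₂] with h hh₁ hh₂
  rw [Function.comp_apply, Function.comp_apply, hh₁, hh₂]
  ring

theorem HasSlopes.iterate {σ : ℝ} {G : ℝ → ℝ} (hσ : 0 ≤ σ) (hG : HasSlopes σ G) (m : ℕ) :
    HasSlopes (σ ^ m) (G^[m]) := by
  induction m with
  | zero => exact fun x e he => ⟨e, he, Eventually.of_forall fun h => by simp⟩
  | succ m ih =>
    rw [Function.iterate_succ, pow_succ]
    exact ih.comp hσ hG

theorem volume_image_eq_of_eqOn_affine {G : ℝ → ℝ} {A : Set ℝ} {a b : ℝ}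
    (h : ∀ y ∈ A, G y = a * y + b) :
    volume (G '' A) = ENNReal.ofReal |a| * volume A := by
  have : G '' A = (fun y => y + b) '' ((fun y => a * y) '' A) := by
    rw [image_image]
    exact image_congr h
  rw [this, image_add_right, measure_preimage_add_right]
  have := Measure.addHaar_smul volume a A
  rwa [Module.finrank_self, pow_one] at this

theorem HasSlopes.exists_ball {σ : ℝ} {G : ℝ → ℝ} (hσ : 0 < σ) (hG : HasSlopes σ G) (x : ℝ) :
    ∃ r > 0, ∀ A ⊆ Metric.ball x r,
      ENNReal.ofReal σ * volume A ≤ 2 * volume (G '' A) := by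
  have key : ∀ e : ℝ, |e| = 1 → ∃ r > 0, ∀ A ⊆ Metric.ball x r, (∀ y ∈ A, 0 ≤ e * (y - x)) →
      ENNReal.ofReal σ * volume A = volume (G '' A) := by
    intro e he
    obtain ⟨e', he', h⟩ := hG x e he
    rw [eventually_nhdsWithin_iff, Metric.eventually_nhds_iff] at h
    obtain ⟨r, hr, h⟩ := h
    refine ⟨r, hr, fun A hA hA' => ?_⟩
    have hee : e * e = 1 := by rw [← abs_mul_abs_self, he, one_mul]
    rw [volume_image_eq_of_eqOn_affine (a := e' * σ * e) (b := G x - e' * σ * e * x)]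
    · rw [abs_mul, abs_mul, he, he', abs_of_pos hσ, one_mul, mul_one]
    · intro y hy
      have := h (y := e * (y - x)) (by
        have := hA hy
        rw [Metric.mem_ball, Real.dist_eq] at this
        rwa [Real.dist_eq, sub_zero, abs_mul, he, one_mul]) (hA' y hy)
      rw [← mul_assoc, hee, one_mul, add_sub_cancel] at this
      rw [this]
      ring
  obtain ⟨r₁, hr₁, h₁⟩ := key 1 (by simp)
  obtain ⟨r₂, hr₂, h₂⟩ := key (-1) (by simp)
  refine ⟨min r₁ r₂, lt_min hr₁ hr₂, fun A hA => ?_⟩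
  have e₁ := h₁ (A ∩ Ici x)
    ((inter_subset_left.trans hA).trans (Metric.ball_subset_ball (min_le_left _ _)))
    (fun y hy => by have := hy.2; rw [mem_Ici] at this; linarith)
  have e₂ := h₂ (A ∩ Iic x)
    ((inter_subset_left.trans hA).trans (Metric.ball_subset_ball (min_le_right _ _)))
    (fun y hy => by have := hy.2; rw [mem_Iic] at this; linarith)
  have hcov : A ⊆ (A ∩ Ici x) ∪ (A ∩ Iic x) := fun y hy =>
    (le_total x y).imp (fun h => ⟨hy, h⟩) (fun h => ⟨hy, h⟩)
  calc ENNReal.ofReal σ * volume A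
      ≤ ENNReal.ofReal σ * (volume (A ∩ Ici x) + volume (A ∩ Iic x)) := by
        gcongr
        exact (measure_mono hcov).trans (measure_union_le _ _)
    _ = volume (G '' (A ∩ Ici x)) + volume (G '' (A ∩ Iic x)) := by rw [mul_add, e₁, e₂]
    _ ≤ volume (G '' A) + volume (G '' A) := by gcongr <;> exact inter_subset_left
    _ = 2 * volume (G '' A) := (two_mul _).symm

/-- A set whose first `n` iterates under `G` stay small has volume decaying like `(2 / σ) ^ n`. -/
theorem HasSlopes.exists_volume_le {σ : ℝ} {G : ℝ → ℝ} (hσ : 0 < σ) (hG : HasSlopes σ G)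
    {J F : Set ℝ} (hJ : IsCompact J) (hFJ : F ⊆ J) (hF : MapsTo G F F) :
    ∃ δ > 0, ∀ (n : ℕ) (A : Set ℝ), A ⊆ F →
      (∀ k < n, ∀ y ∈ A, ∀ z ∈ A, dist (G^[k] y) (G^[k] z) < δ) →
      ENNReal.ofReal σ ^ n * volume A ≤ 2 ^ n * volume J := by
  choose r hr h using hG.exists_ball hσ
  obtain ⟨δ, hδ, hc⟩ := lebesgue_number_lemma_of_metric (c := fun x => Metric.ball x (r x)) hJ
    (fun _ => Metric.isOpen_ball)
    (fun x _ => mem_iUnion.2 ⟨x, Metric.mem_ball_self (hr x)⟩)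
  refine ⟨δ, hδ, fun n => ?_⟩
  induction n with
  | zero => exact fun A hA _ => by simpa using measure_mono (hA.trans hFJ)
  | succ n ih =>
    intro A hA hd
    rcases A.eq_empty_or_nonempty with rfl | ⟨y, hy⟩
    · simp
    obtain ⟨i, hi⟩ := hc y (hFJ (hA hy))
    have hAi : A ⊆ Metric.ball i (r i) := fun z hz =>
      hi (by simpa using hd 0 n.succ_pos z hz y hy)
    have h₁ := h i A hAi
    have h₂ := ih (G '' A) ((image_mono hA).trans hF.image_subset) (by
      rintro k hk _ ⟨y, hy, rfl⟩ _ ⟨z, hz, rfl⟩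
      have := hd (k + 1) (by lia) y hy z hz
      rwa [Function.iterate_succ_apply, Function.iterate_succ_apply] at this)
    calc ENNReal.ofReal σ ^ (n + 1) * volume A
        = ENNReal.ofReal σ ^ n * (ENNReal.ofReal σ * volume A) := by rw [pow_succ, mul_assoc]
      _ ≤ ENNReal.ofReal σ ^ n * (2 * volume (G '' A)) := by gcongr
      _ = 2 * (ENNReal.ofReal σ ^ n * volume (G '' A)) := by ring
      _ ≤ 2 * (2 ^ n * volume J) := by gcongr
      _ = 2 ^ (n + 1) * volume J := by ring

theorem le_of_eventually_const_mul_pow_le {C a b : ℝ} (hC : 0 < C) (hb : 0 < b)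
    (h : ∀ᶠ k : ℕ in atTop, C * a ^ k ≤ b ^ k) : a ≤ b := by
  by_contra! hab
  have ht := tendsto_pow_atTop_atTop_of_one_lt ((one_lt_div hb).2 hab)
  obtain ⟨k, hk, hk'⟩ := (h.and (ht.eventually_gt_atTop C⁻¹)).exists
  rw [div_pow, lt_div_iff₀ (pow_pos hb k), inv_mul_lt_iff₀ hC] at hk'
  exact hk'.not_ge hk

theorem HasSlopes.log_le_coverEntropy {s : ℝ} {T : ℝ → ℝ} (hs : 0 < s) (hT : HasSlopes s T)
    {J F : Set ℝ} (hJ : IsCompact J) (hFJ : F ⊆ J) (hF : MapsTo T F F) (hvol : volume F ≠ 0) :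
    (Real.log s : EReal) ≤ coverEntropy T F := by
  by_contra! hlt
  obtain ⟨r, hr, hrs⟩ := EReal.lt_iff_exists_real_btwn.1 hlt
  rw [EReal.coe_lt_coe_iff] at hrs
  obtain ⟨m, hm⟩ := exists_nat_gt (Real.log 2 / (Real.log s - r))
  rw [div_lt_iff₀ (sub_pos.2 hrs)] at hm
  have hm0 : 0 < m := by
    rcases Nat.eq_zero_or_pos m with rfl | h
    · have := Real.log_pos one_lt_two
      simp at hm
      linarith
    · exact h
  have hσ : 0 < s ^ m := pow_pos hs m
  obtain ⟨δ, hδ, hA⟩ := (hT.iterate hs.le m).exists_volume_le hσ hJ hFJ (hF.iterate m)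
  set U : SetRel ℝ ℝ := {p | dist p.1 p.2 < δ / 2}
  have hUu : U ∈ uniformity ℝ := Metric.dist_mem_uniformity (half_pos hδ)
  have hgrowth := ExpGrowth.eventually_le_exp
    ((coverEntropyEntourage_le_coverEntropy T F hUu).trans_lt hr)
  have hJtop : volume J ≠ ⊤ := hJ.measure_lt_top.ne
  have hFtop : volume F ≠ ⊤ := ((measure_mono hFJ).trans_lt hJ.measure_lt_top).ne
  have hV : 0 < (volume F).toReal := ENNReal.toReal_pos hvol hFtop
  have hW : 0 < (volume J).toReal :=
    ENNReal.toReal_pos (fun h => hvol (measure_mono_null hFJ h)) hJtop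
  have hcard : ∀ (k : ℕ) (t : Finset ℝ), IsDynCoverOf T F U (m * k) t →
      (s ^ m) ^ k * (volume F).toReal ≤ t.card * (2 ^ k * (volume J).toReal) := by
    intro k t ht
    set B : ℝ → Set ℝ := fun x => {y ∈ F | (y, x) ∈ dynEntourage T U (m * k)}
    have hB : ∀ x, ENNReal.ofReal (s ^ m) ^ k * volume (B x) ≤ 2 ^ k * volume J := by
      refine fun x => hA k (B x) (fun y hy => hy.1) fun j hj y hy z hz => ?_
      have h₁ := mem_dynEntourage.1 hy.2 (m * j) (Nat.mul_lt_mul_of_pos_left hj hm0)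
      have h₂ := mem_dynEntourage.1 hz.2 (m * j) (Nat.mul_lt_mul_of_pos_left hj hm0)
      rw [← Function.iterate_mul]
      calc _ ≤ _ := dist_triangle_right _ _ (T^[m * j] x)
        _ < δ / 2 + δ / 2 := add_lt_add h₁ h₂
        _ = δ := add_halves δ
    have hcov : F ⊆ ⋃ x ∈ t, B x := fun y hy => by
      obtain ⟨x, hx, hxy⟩ := ht hy
      exact mem_biUnion hx ⟨hy, hxy⟩
    have : ENNReal.ofReal (s ^ m) ^ k * volume F ≤ t.card * (2 ^ k * volume J) := by
      calc ENNReal.ofReal (s ^ m) ^ k * volume F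
          ≤ ENNReal.ofReal (s ^ m) ^ k * ∑ x ∈ t, volume (B x) := by
            gcongr
            exact (measure_mono hcov).trans (measure_biUnion_finset_le _ _)
        _ = ∑ x ∈ t, ENNReal.ofReal (s ^ m) ^ k * volume (B x) := Finset.mul_sum _ _ _
        _ ≤ ∑ x ∈ t, 2 ^ k * volume J := Finset.sum_le_sum fun x _ => hB x
        _ = t.card * (2 ^ k * volume J) := by rw [Finset.sum_const, nsmul_eq_mul]
    have := ENNReal.toReal_mono (by finiteness) this
    simpa [hs.le, ENNReal.toReal_ofReal hσ.le] using this
  have key : s ^ m / 2 ≤ Real.exp (r * m) := by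
    refine le_of_eventually_const_mul_pow_le (C := (volume F).toReal / (volume J).toReal)
      (div_pos hV hW) (Real.exp_pos _) ?_
    filter_upwards [(tendsto_id.const_mul_atTop' hm0).eventually hgrowth] with k hk
    rw [id, ← EReal.coe_natCast, ← EReal.coe_mul, EReal.exp_coe] at hk
    have hfin : coverMincard T F U (m * k) < ⊤ :=
      ENat.toENNReal_lt_top.1 (hk.trans_lt ENNReal.ofReal_lt_top)
    obtain ⟨t, ht, htc⟩ := (coverMincard_finite_iff T F U _).1 hfin
    rw [← htc, ENat.toENNReal_coe, ← ENNReal.ofReal_natCast,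
      ENNReal.ofReal_le_ofReal_iff (Real.exp_pos _).le] at hk
    have h := hcard k t ht
    have hexp : Real.exp (r * m) ^ k = Real.exp (r * (m * k : ℕ)) := by
      rw [← Real.exp_nat_mul]
      push_cast
      ring_nf
    rw [hexp]
    refine le_trans ?_ hk
    rw [div_pow, div_mul_div_comm, div_le_iff₀ (by positivity)]
    linarith
  have := Real.log_le_log (by positivity) key
  rw [Real.log_exp, Real.log_div hσ.ne' two_ne_zero, Real.log_pow] at this
  linarith

theorem LipschitzWith.coverEntropy_Icc_le {s : NNReal} {T : ℝ → ℝ} (hT : LipschitzWith s T)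
    (hs : 1 ≤ s) (a b : ℝ) : coverEntropy T (Icc a b) ≤ ENNReal.log s := by
  rw [coverEntropy_eq_iSup_basis Metric.uniformity_basis_dist]
  refine iSup₂_le fun ε hε => ?_
  have hs' : (1 : ℝ) ≤ s := hs
  have hC : 0 ≤ |b - a| / ε := by positivity
  rw [← ExpGrowth.expGrowthSup_pow]
  refine ExpGrowth.expGrowthSup_le_of_eventually_le (b := ENNReal.ofReal (|b - a| / ε + 2))
    ENNReal.ofReal_ne_top (Eventually.of_forall fun n => ?_)
  set η : ℝ := ε / s ^ n with hη
  have hη0 : 0 < η := by positivity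
  set N := ⌊|b - a| / η⌋₊ + 1
  have hcov : IsDynCoverOf T (Icc a b) {p | dist p.1 p.2 < ε} n
      ((Finset.range N).image fun i : ℕ => a + i * η : Finset ℝ) := by
    intro y hy
    have hya : 0 ≤ y - a := sub_nonneg.2 hy.1
    have h₀ : 0 ≤ (y - a) / η := by positivity
    refine ⟨a + ⌊(y - a) / η⌋₊ * η, ?_, mem_dynEntourage.2 fun k hk => ?_⟩
    · rw [Finset.coe_image]
      refine mem_image_of_mem _ ?_
      rw [Finset.mem_coe, Finset.mem_range, Nat.lt_succ_iff]
      refine Nat.floor_mono ?_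
      gcongr
      exact (sub_le_sub_right hy.2 a).trans (le_abs_self _)
    · have h₁ := Nat.floor_le h₀
      have h₂ := Nat.lt_floor_add_one ((y - a) / η)
      rw [le_div_iff₀ hη0] at h₁
      rw [div_lt_iff₀ hη0] at h₂
      have hd : dist y (a + ⌊(y - a) / η⌋₊ * η) < η := by
        rw [Real.dist_eq, abs_lt]
        constructor <;> linarith
      refine ((hT.iterate k).dist_le_mul _ _).trans_lt ?_
      push_cast
      calc _ < (s : ℝ) ^ k * η := by gcongr
        _ ≤ (s : ℝ) ^ n * η := by gcongr
        _ = ε := by rw [hη]; field_simp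
  have hcard : ((Finset.range N).image fun i : ℕ => a + i * η).card ≤ N :=
    Finset.card_image_le.trans_eq (Finset.card_range N)
  have hN : (N : ℝ) ≤ (|b - a| / ε + 2) * s ^ n := by
    have h₁ := Nat.floor_le (a := |b - a| / η) (by positivity)
    have h₂ : |b - a| / η = |b - a| / ε * s ^ n := by rw [hη]; field_simp
    have h₃ : 1 ≤ (s : ℝ) ^ n := one_le_pow₀ hs'
    simp only [N, Nat.cast_add, Nat.cast_one]
    rw [h₂] at h₁ ⊢
    nlinarith
  calc (coverMincard T (Icc a b) {p | dist p.1 p.2 < ε} n : ENNReal)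
      ≤ ((N : ℕ∞) : ENNReal) := by
        gcongr
        exact hcov.coverMincard_le_card.trans (by exact_mod_cast hcard)
    _ = ENNReal.ofReal N := by simp
    _ ≤ ENNReal.ofReal ((|b - a| / ε + 2) * s ^ n) := ENNReal.ofReal_le_ofReal hN
    _ = _ := by
      rw [ENNReal.ofReal_mul (by positivity), ENNReal.ofReal_pow (by positivity),
        ENNReal.ofReal_coe_nnreal]

/-- The real numbers whose square is a natural number. -/
def sqrtNats : Set ℝ := {y | ∃ n : ℕ, y ^ 2 = n}

theorem sqrt_natCast_mem_sqrtNats (n : ℕ) : √(n : ℝ) ∈ sqrtNats :=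
  ⟨n, Real.sq_sqrt n.cast_nonneg⟩

theorem neg_mem_sqrtNats {y : ℝ} (hy : y ∈ sqrtNats) : -y ∈ sqrtNats := by
  obtain ⟨n, hn⟩ := hy
  exact ⟨n, by rw [neg_sq, hn]⟩

theorem zero_mem_sqrtNats : (0 : ℝ) ∈ sqrtNats := ⟨0, by simp⟩

/-- The distance to the nearest number whose square is a natural number. -/
noncomputable def zigzag (u : ℝ) : ℝ := Metric.infDist u sqrtNats

theorem zigzag_nonneg (u : ℝ) : 0 ≤ zigzag u := Metric.infDist_nonneg

theorem zigzag_zero : zigzag 0 = 0 := Metric.infDist_zero_of_mem zero_mem_sqrtNats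

theorem continuous_zigzag : Continuous zigzag := Metric.continuous_infDist_pt _

theorem zigzag_le_of_mem {u p : ℝ} (hp : p ∈ sqrtNats) : zigzag u ≤ |u - p| :=
  Metric.infDist_le_dist_of_mem hp

theorem zigzag_neg (u : ℝ) : zigzag (-u) = zigzag u := by
  have key : ∀ u, zigzag (-u) ≤ zigzag u := fun u =>
    (Metric.le_infDist ⟨0, zero_mem_sqrtNats⟩).2 fun y hy => by
      refine (zigzag_le_of_mem (neg_mem_sqrtNats hy)).trans_eq ?_
      rw [Real.dist_eq, ← abs_neg]
      ring_nf
  exact (key u).antisymm (by simpa using key (-u))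

theorem zigzag_le (u : ℝ) : zigzag u ≤ 1 ∧ |u| * zigzag u ≤ 1 := by
  wlog hu : 0 ≤ u
  · have := this (-u) (by linarith)
    rwa [zigzag_neg, abs_neg] at this
  rw [abs_of_nonneg hu]
  set n := ⌊u ^ 2⌋₊
  have h₁ : (n : ℝ) ≤ u ^ 2 := Nat.floor_le (sq_nonneg u)
  have h₂ : u ^ 2 < n + 1 := Nat.lt_floor_add_one _
  have h₃ : √(n : ℝ) ≤ u := Real.sqrt_le_iff.2 ⟨hu, h₁⟩
  have h₄ : √(n : ℝ) ^ 2 = n := Real.sq_sqrt n.cast_nonneg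
  have h₅ := Real.sqrt_nonneg (n : ℝ)
  have h := zigzag_le_of_mem (u := u) (sqrt_natCast_mem_sqrtNats n)
  rw [abs_of_nonneg (sub_nonneg.2 h₃)] at h
  constructor <;> nlinarith

theorem zigzag_eq_min {p q y : ℝ} (hp : p ∈ sqrtNats) (hq : q ∈ sqrtNats)
    (hpq : ∀ z ∈ sqrtNats, z ≤ p ∨ q ≤ z) (hy : y ∈ Icc p q) :
    zigzag y = min (y - p) (q - y) := by
  refine le_antisymm (le_min ?_ ?_) ?_
  · exact (zigzag_le_of_mem hp).trans_eq (abs_of_nonneg (sub_nonneg.2 hy.1))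
  · refine (zigzag_le_of_mem hq).trans_eq ?_
    rw [abs_sub_comm, abs_of_nonneg (sub_nonneg.2 hy.2)]
  · refine (Metric.le_infDist ⟨0, zero_mem_sqrtNats⟩).2 fun z hz => ?_
    rw [Real.dist_eq]
    rcases hpq z hz with h | h
    · exact (min_le_left _ _).trans ((sub_le_sub_left h y).trans (le_abs_self _))
    · exact (min_le_right _ _).trans ((sub_le_sub_right h y).trans
        (by rw [abs_sub_comm]; exact le_abs_self _))

theorem exists_sqrtNats_gap (x : ℝ) : ∃ p ∈ sqrtNats, ∃ q ∈ sqrtNats,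
    p ≤ x ∧ x < q ∧ ∀ z ∈ sqrtNats, z ≤ p ∨ q ≤ z := by
  rcases le_or_gt 0 x with hx | hx
  · set n := ⌊x ^ 2⌋₊
    have h₁ : (n : ℝ) ≤ x ^ 2 := Nat.floor_le (sq_nonneg x)
    have h₂ : x ^ 2 < (n + 1 : ℕ) := by push_cast; exact Nat.lt_floor_add_one _
    refine ⟨_, sqrt_natCast_mem_sqrtNats n, _, sqrt_natCast_mem_sqrtNats (n + 1),
      Real.sqrt_le_iff.2 ⟨hx, h₁⟩, Real.lt_sqrt_of_sq_lt h₂, ?_⟩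
    rintro z ⟨k, hk⟩
    rcases Nat.lt_or_ge n k with h | h
    · rcases le_or_gt z 0 with hz | hz
      · exact Or.inl (hz.trans (Real.sqrt_nonneg _))
      · exact Or.inr (Real.sqrt_le_iff.2 ⟨hz.le, by rw [hk]; exact_mod_cast h⟩)
    · exact Or.inl (Real.le_sqrt_of_sq_le (by rw [hk]; exact_mod_cast h))
  · obtain ⟨n, hn⟩ : ∃ n, ⌈x ^ 2⌉₊ = n + 1 :=
      Nat.exists_eq_succ_of_ne_zero (Nat.ceil_pos.2 (sq_pos_of_neg hx)).ne'
    have h₁ : x ^ 2 ≤ (n + 1 : ℕ) := by rw [← hn]; exact Nat.le_ceil _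
    have h₂ : (n : ℝ) < x ^ 2 := Nat.lt_ceil.1 (by lia)
    refine ⟨_, neg_mem_sqrtNats (sqrt_natCast_mem_sqrtNats (n + 1)), _,
      neg_mem_sqrtNats (sqrt_natCast_mem_sqrtNats n), ?_, ?_, ?_⟩
    · exact neg_le.1 (Real.le_sqrt_of_sq_le (by rwa [neg_sq]))
    · exact lt_neg.1 ((Real.sqrt_lt' (neg_pos.2 hx)).2 (by rwa [neg_sq]))
    rintro z ⟨k, hk⟩
    rcases Nat.lt_or_ge n k with h | h
    · rcases le_or_gt 0 z with hz | hz
      · exact Or.inr ((neg_nonpos.2 (Real.sqrt_nonneg _)).trans hz)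
      · refine Or.inl (le_neg.1 (Real.sqrt_le_iff.2 ⟨by linarith, ?_⟩))
        rw [neg_sq, hk]
        exact_mod_cast h
    · refine Or.inr (neg_le.1 (Real.le_sqrt_of_sq_le ?_))
      rw [neg_sq, hk]
      exact_mod_cast h

theorem zigzag_right_slope (x : ℝ) : ∃ e : ℝ, |e| = 1 ∧
    ∀ᶠ h in 𝓝[≥] (0 : ℝ), zigzag (x + h) = zigzag x + e * h := by
  obtain ⟨p, hp, q, hq, hpx, hxq, hpq⟩ := exists_sqrtNats_gap x
  have hx : zigzag x = min (x - p) (q - x) := zigzag_eq_min hp hq hpq ⟨hpx, hxq.le⟩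
  have hsmall : ∀ r : ℝ, 0 < r → ∀ᶠ h in 𝓝[≥] (0 : ℝ), 0 ≤ h ∧ h < r := fun r hr => by
    filter_upwards [self_mem_nhdsWithin, mem_nhdsWithin_of_mem_nhds (gt_mem_nhds hr)] with h h₁ h₂
    exact ⟨h₁, h₂⟩
  rcases lt_or_ge (x - p) (q - x) with hlt | hge
  · refine ⟨1, abs_one, ?_⟩
    filter_upwards [hsmall ((q - x - (x - p)) / 2) (by linarith)] with h hh
    rw [hx, min_eq_left hlt.le, zigzag_eq_min hp hq hpq (by constructor <;> linarith),
      min_eq_left (by linarith)]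
    ring
  · refine ⟨-1, by simp, ?_⟩
    filter_upwards [hsmall (q - x) (by linarith)] with h hh
    rw [hx, min_eq_right hge, zigzag_eq_min hp hq hpq (by constructor <;> linarith),
      min_eq_right (by linarith)]
    ring

theorem hasSlopes_zigzag (c s : ℝ) : HasSlopes s (fun u => c + s * zigzag u) := by
  intro x e he
  rcases eq_or_eq_neg_of_abs_eq he with rfl | rfl
  · obtain ⟨e', he', h⟩ := zigzag_right_slope x
    refine ⟨e', he', h.mono fun y hy => ?_⟩
    beta_reduce
    rw [one_mul, hy]
    ring
  · obtain ⟨e', he', h⟩ := zigzag_right_slope (-x)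
    refine ⟨e', he', h.mono fun y hy => ?_⟩
    beta_reduce
    rw [← zigzag_neg x, ← zigzag_neg (x + -1 * y), show -(x + -1 * y) = -x + y by ring, hy]
    ring

theorem lipschitzWith_zigzag (c : ℝ) (s : NNReal) :
    LipschitzWith s (fun u => c + s * zigzag u) := by
  refine LipschitzWith.of_dist_le_mul fun x y => ?_
  have h := (Metric.lipschitz_infDist_pt sqrtNats).dist_le_mul x y
  rw [NNReal.coe_one, one_mul] at h
  rw [dist_add_left, Real.dist_eq, ← mul_sub, abs_mul, NNReal.abs_eq]
  gcongr
  exact h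

/-- Conjugating `u ↦ s * zigzag u` by the logarithm makes multiplication by positive scalars
into translation. -/
noncomputable def expZigzag (s x : ℝ) : ℝ := Real.exp (s * zigzag (Real.log x))

theorem continuous_expZigzag (s : ℝ) : Continuous (expZigzag s) := by
  refine Real.continuous_exp.comp (continuous_const.mul ?_)
  refine continuous_iff_continuousAt.2 fun x => ?_
  rcases eq_or_ne x 0 with rfl | hx
  · refine continuousAt_iff_punctured_nhds.2 ?_
    rw [Real.log_zero, zigzag_zero]
    have hlim : Tendsto (fun x => |Real.log x|⁻¹) (𝓝[≠] 0) (𝓝 0) :=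
      (tendsto_abs_atBot_atTop.comp Real.tendsto_log_nhdsNE_zero).inv_tendsto_atTop
    refine tendsto_of_tendsto_of_tendsto_of_le_of_le' tendsto_const_nhds hlim
      (Eventually.of_forall fun x => zigzag_nonneg _) ?_
    filter_upwards [(tendsto_abs_atBot_atTop.comp
      Real.tendsto_log_nhdsNE_zero).eventually_gt_atTop 0] with x hx
    rw [Function.comp_apply] at hx
    rw [← one_div, le_div_iff₀ hx, mul_comm]
    exact (zigzag_le _).2
  · exact continuous_zigzag.continuousAt.comp (Real.continuousAt_log hx)

theorem htop_mul_expZigzag {s : NNReal} (hs : 1 ≤ s) {lam : ℝ} (hlam : 0 < lam) :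
    htop (fun x => lam * expZigzag s x) = ENNReal.log s := by
  have hs0 : (0 : ℝ) < s := lt_of_lt_of_le one_pos hs
  set c := Real.log lam with hc
  set S : ℝ → ℝ := fun u => c + s * zigzag u with hS
  set T : ℝ → ℝ := fun x => lam * expZigzag s x with hT
  have hTexp : ∀ x, T x = Real.exp (S (Real.log x)) := fun x => by
    rw [hT, hS, hc, Real.exp_add, Real.exp_log hlam]
    rfl
  have hSmem : ∀ u, S u ∈ Icc c (c + s) := fun u => by
    have := mul_nonneg hs0.le (zigzag_nonneg u)
    have := mul_le_of_le_one_right hs0.le (zigzag_le u).1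
    constructor <;> simp only [S] <;> linarith
  have hrange : range T = Real.exp '' range S := by
    ext y
    constructor
    · rintro ⟨x, rfl⟩
      exact ⟨_, ⟨_, rfl⟩, (hTexp x).symm⟩
    · rintro ⟨_, ⟨u, rfl⟩, rfl⟩
      exact ⟨Real.exp u, by rw [hTexp, Real.log_exp]⟩
  have hcl : closure (range T) ⊆ Real.exp '' Icc c (c + s) := by
    refine closure_minimal ?_ (isCompact_Icc.image Real.continuous_exp).isClosed
    rw [hrange]
    exact image_mono (range_subset_iff.2 hSmem)
  refine le_antisymm ?_ ?_
  · calc coverEntropy T (closure (range T))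
        ≤ coverEntropy T (Real.exp '' Icc c (c + s)) := coverEntropy_monotone T hcl
      _ ≤ coverEntropy S (Icc c (c + s)) :=
          coverEntropy_image_le_of_uniformContinuousOn_invariant
            (fun u => by rw [hTexp, Real.log_exp])
            (isCompact_Icc.uniformContinuousOn_of_continuous Real.continuous_exp.continuousOn)
            Subset.rfl (fun u _ => hSmem u)
      _ ≤ ENNReal.log s := (lipschitzWith_zigzag c s).coverEntropy_Icc_le hs _ _
  · have hlog : coverEntropy S (Real.log '' range T) ≤ coverEntropy T (range T) := by
      refine coverEntropy_image_le_of_uniformContinuousOn_invariant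
        (fun x => by rw [hTexp, Real.log_exp])
        (G := Real.exp '' Icc c (c + s)) ?_ (subset_closure.trans hcl) ?_
      · refine (isCompact_Icc.image Real.continuous_exp).uniformContinuousOn_of_continuous ?_
        rintro _ ⟨u, _, rfl⟩
        exact (Real.continuousAt_log (Real.exp_ne_zero u)).continuousWithinAt
      · exact fun x _ => ⟨_, hSmem _, (hTexp x).symm⟩
    have himage : Real.log '' range T = range S := by
      rw [hrange, image_image]
      simp
    rw [himage] at hlog
    have hvol : volume (range S) ≠ 0 := by
      have hconn : OrdConnected (range S) :=
        (isPreconnected_range (lipschitzWith_zigzag c s).continuous).ordConnected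
      have h₀ : S 0 = c := by simp [S, zigzag_zero]
      have h₁ : c < S (1 / 2) := by
        have : zigzag (1 / 2) = 1 / 2 := by
          rw [zigzag_eq_min (p := 0) (q := 1) zero_mem_sqrtNats ⟨1, by simp⟩ _ (by norm_num)]
          · norm_num
          · rintro z ⟨n, hn⟩
            by_contra! h
            have h₁ : (0 : ℝ) < n := by rw [← hn]; exact pow_pos h.1 2
            have h₂ : (n : ℝ) < 1 := by rw [← hn]; nlinarith
            norm_cast at h₁ h₂
            lia
        simp only [S, this]
        linarith
      have hsub : Icc c (S (1 / 2)) ⊆ range S := by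
        rw [← h₀]
        exact hconn.out ⟨0, rfl⟩ ⟨_, rfl⟩
      refine fun h => (measure_mono_null hsub h).not_gt ?_
      rw [Real.volume_Icc, ENNReal.ofReal_pos]
      linarith
    calc ENNReal.log s = (Real.log s : EReal) := by
          rw [← ENNReal.ofReal_coe_nnreal, ENNReal.log_ofReal_of_pos hs0]
      _ ≤ coverEntropy S (range S) := (hasSlopes_zigzag c s).log_le_coverEntropy hs0 isCompact_Icc
          (range_subset_iff.2 hSmem) (mapsTo_range S _ |>.mono_left (subset_univ _)) hvol
      _ ≤ coverEntropy T (range T) := hlog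
      _ ≤ coverEntropy T (closure (range T)) := coverEntropy_monotone T subset_closure

theorem log_le_coverEntropy_of_image_supset {X : Type*} [UniformSpace X] [T2Space X] {T : X → X}
    {d : ℕ} {J : Fin d → Set X} {F : Set X} (hcomp : ∀ i, IsCompact (J i))
    (hdisj : ∀ i j, i ≠ j → Disjoint (J i) (J j)) (hne : ∀ i, (J i).Nonempty)
    (hcov : ∀ i j, J j ⊆ T '' J i) (hF : ∀ i, J i ⊆ F) :
    ENNReal.log d ≤ coverEntropy T F := by
  have hV : ∀ i j, ∃ V ∈ uniformity X, i ≠ j →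
      Disjoint (⋃ x ∈ J i, UniformSpace.ball x V) (⋃ x ∈ J j, UniformSpace.ball x V) := by
    intro i j
    by_cases h : i = j
    · exact ⟨univ, univ_mem, fun h' => (h' h).elim⟩
    · obtain ⟨V, hV, hd⟩ := (hdisj i j h).exists_uniform_thickening (hcomp i) (hcomp j).isClosed
      exact ⟨V, hV, fun _ => hd⟩
  choose V hV hVd using hV
  set U : SetRel X X := ⋂ i, ⋂ j, V i j
  have hUu : U ∈ uniformity X := iInter_mem.2 fun i => iInter_mem.2 fun j => hV i j
  have hword : ∀ (n : ℕ) (w : Fin (n + 1) → Fin d), ∃ x, ∀ k, T^[(k : ℕ)] x ∈ J (w k) := by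
    intro n
    induction n with
    | zero =>
      intro w
      obtain ⟨x, hx⟩ := hne (w 0)
      refine ⟨x, fun k => ?_⟩
      rw [Fin.fin_one_eq_zero k]
      exact hx
    | succ n ih =>
      intro w
      obtain ⟨y, hy⟩ := ih (Fin.tail w)
      obtain ⟨x, hx, rfl⟩ := hcov (w 0) _ (hy 0)
      exact ⟨x, Fin.cases hx fun k => hy k⟩
  refine le_trans ?_ (netEntropyEntourage_le_coverEntropy T F hUu)
  rw [← ExpGrowth.expGrowthSup_pow]
  refine ExpGrowth.expGrowthSup_eventually_monotone ?_
  filter_upwards [eventually_gt_atTop 0] with n hn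
  obtain ⟨n, rfl⟩ := Nat.exists_eq_succ_of_ne_zero hn.ne'
  choose x hx using hword n
  have hballs : ∀ w w', w ≠ w' → Disjoint (UniformSpace.ball (x w) (dynEntourage T U (n + 1)))
      (UniformSpace.ball (x w') (dynEntourage T U (n + 1))) := by
    intro w w' hww
    obtain ⟨k, hk⟩ := Function.ne_iff.1 hww
    refine Set.disjoint_left.2 fun z hz hz' => ?_
    have hUV : U ⊆ V (w k) (w' k) := (iInter_subset _ _).trans (iInter_subset _ _)
    refine Set.disjoint_left.1 (hVd _ _ hk)
      (mem_biUnion (hx w k) (hUV (mem_dynEntourage.1 hz k k.2)))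
      (mem_biUnion (hx w' k) (hUV (mem_dynEntourage.1 hz' k k.2)))
  have hinj : Function.Injective x := by
    intro w w' h
    by_contra hww
    obtain ⟨k, hk⟩ := Function.ne_iff.1 hww
    exact Set.disjoint_left.1 (hdisj _ _ hk) (hx w k) (h ▸ hx w' k)
  have hnet : IsDynNetIn T F U (n + 1) (Finset.univ.map ⟨x, hinj⟩ : Finset X) := by
    rw [Finset.coe_map, Finset.coe_univ, image_univ]
    refine ⟨range_subset_iff.2 fun w => hF _ (hx w 0), ?_⟩
    rintro _ ⟨w, rfl⟩ _ ⟨w', rfl⟩ h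
    exact hballs w w' fun hw => h (by rw [hw])
  have := hnet.card_le_netMaxcard
  rw [Finset.card_map, Finset.card_univ, Fintype.card_fun, Fintype.card_fin, Fintype.card_fin]
    at this
  calc ((d : ENNReal) ^ (n + 1)) = (((d ^ (n + 1) : ℕ) : ℕ∞) : ENNReal) := by simp
    _ ≤ _ := ENat.toENNReal_mono this

/-- An even bounded continuous function whose oscillations near `0` are steep at every scale. -/
noncomputable def wave (x : ℝ) : ℝ := min 1 √|x| * Real.sin |x|⁻¹

theorem abs_wave_le (x : ℝ) : |wave x| ≤ min 1 √|x| := by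
  rw [wave, abs_mul, abs_of_nonneg (le_min zero_le_one (Real.sqrt_nonneg _))]
  exact mul_le_of_le_one_right (le_min zero_le_one (Real.sqrt_nonneg _)) (Real.abs_sin_le_one _)

theorem continuous_wave : Continuous wave := by
  refine continuous_iff_continuousAt.2 fun x => ?_
  rcases eq_or_ne x 0 with rfl | hx
  · have h₀ : wave 0 = 0 := by simp [wave]
    rw [ContinuousAt, h₀]
    refine squeeze_zero_norm (fun x => (abs_wave_le x).trans (min_le_right _ _)) ?_
    have : Continuous fun x : ℝ => √|x| := by fun_prop
    simpa using this.tendsto 0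
  · have : |x| ≠ 0 := abs_ne_zero.2 hx
    unfold wave
    fun_prop (disch := assumption)

theorem htop_mul_wave {lam : ℝ} (hlam : 0 < lam) : htop (fun x => lam * wave x) = ⊤ := by
  have hpi := Real.pi_pos
  have key : ∀ d : ℕ, ENNReal.log d ≤ htop (fun x => lam * wave x) := by
    intro d
    obtain ⟨K, hK⟩ := exists_nat_gt (max (d + 1 : ℝ) (1 / lam ^ 2))
    obtain ⟨hKd, hKl⟩ := max_lt_iff.1 hK
    have hd0 : (0 : ℝ) ≤ d := d.cast_nonneg
    have hK0 : (0 : ℝ) < K := by linarith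
    set top : ℕ → ℝ := fun i => 2 * Real.pi * (K + i)
    have htop0 : ∀ i, 0 < top i := fun i => by
      have : (0 : ℝ) < K + i := by positivity
      positivity
    set J : Fin d → Set ℝ := fun i => Icc (top i + Real.pi / 2)⁻¹ (top i)⁻¹
    have hJpos : ∀ i, ∀ x ∈ J i, 0 < x := fun i x hx =>
      lt_of_lt_of_le (by have := htop0 i; positivity) hx.1
    have hcov : ∀ i j, J j ⊆ (fun x => lam * wave x) '' J i := by
      intro i j y hy
      have hle : (top i + Real.pi / 2)⁻¹ ≤ (top i)⁻¹ :=
        inv_anti₀ (htop0 i) (by linarith)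
      have hivt := intermediate_value_uIcc (a := (top i)⁻¹) (b := (top i + Real.pi / 2)⁻¹)
        (f := fun x => lam * wave x) (continuous_const.mul continuous_wave).continuousOn
      rw [uIcc_of_ge hle] at hivt
      refine hivt ?_
      have hz : lam * wave (top i)⁻¹ = 0 := by
        have : Real.sin (top i) = 0 := by
          have := Real.sin_nat_mul_two_pi_sub 0 (K + i)
          simp only [top]
          push_cast at this
          rw [sub_zero, Real.sin_zero, neg_zero] at this
          rw [← this]
          ring_nf
        rw [wave, abs_of_pos (inv_pos.2 (htop0 i)), inv_inv, this, mul_zero, mul_zero]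
      have hsin : Real.sin (top i + Real.pi / 2) = 1 := by
        have := Real.cos_nat_mul_two_pi (K + i)
        rw [Real.sin_add_pi_div_two, ← this]
        simp only [top]
        push_cast
        ring_nf
      set b := (top i + Real.pi / 2)⁻¹ with hb
      have hb0 : 0 < b := by have := htop0 i; positivity
      have hi : (i : ℝ) + 1 ≤ d := by exact_mod_cast i.2
      have hb1 : b ≤ 1 := by
        refine inv_le_one_of_one_le₀ ?_
        have : (0 : ℝ) ≤ i := by positivity
        simp only [top]
        nlinarith [Real.pi_gt_three]
      have hw : wave b = √b := by
        rw [wave, abs_of_pos hb0, hb, inv_inv, hsin, mul_one, ← hb,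
          min_eq_right (Real.sqrt_le_one.2 hb1)]
      have hyK : y ≤ (2 * Real.pi * K)⁻¹ := by
        refine hy.2.trans (inv_anti₀ (by positivity) ?_)
        simp only [top]
        gcongr
        linarith [(Nat.cast_nonneg (j : ℕ) : (0 : ℝ) ≤ (j : ℕ))]
      have hbK : (4 * Real.pi * K)⁻¹ ≤ b := by
        refine inv_anti₀ (by have := htop0 i; positivity) ?_
        simp only [top]
        nlinarith
      rw [hz, hw, uIcc_of_le (by positivity)]
      refine ⟨(hJpos j y hy).le, hyK.trans ?_⟩
      rw [div_lt_iff₀ (by positivity)] at hKl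
      refine le_trans ?_ (mul_le_mul_of_nonneg_left (Real.sqrt_le_sqrt hbK) hlam.le)
      rw [← Real.sqrt_sq hlam.le, ← Real.sqrt_mul (sq_nonneg _)]
      refine Real.le_sqrt_of_sq_le ?_
      rw [← div_eq_mul_inv, le_div_iff₀ (by positivity)]
      have : ((2 * Real.pi * K)⁻¹) ^ 2 * (4 * Real.pi * K) = (Real.pi * K)⁻¹ := by
        field_simp
        norm_num
      rw [this, inv_le_iff_one_le_mul₀ (by positivity)]
      nlinarith [Real.pi_gt_three]
    refine log_le_coverEntropy_of_image_supset (J := J) (fun i => isCompact_Icc) ?_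
      (fun i => nonempty_Icc.2 (inv_anti₀ (htop0 i) (by linarith))) hcov
      (fun i => (hcov i i).trans ((image_subset_range _ _).trans subset_closure))
    have hlt : ∀ i j : Fin d, i < j → Disjoint (J i) (J j) := by
      intro i j hij
      refine Set.disjoint_left.2 fun x hx hx' => ?_
      have h : (i : ℝ) + 1 ≤ j := by exact_mod_cast hij
      have h₁ : (top j)⁻¹ < (top i + Real.pi / 2)⁻¹ := by
        refine inv_strictAnti₀ (by have := htop0 i; positivity) ?_
        simp only [top]
        nlinarith
      linarith [hx.1, hx'.2]
    intro i j hij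
    rcases lt_or_gt_of_ne hij with h | h
    · exact hlt i j h
    · exact (hlt j i h).symm
  refine top_le_iff.1 (le_of_tendsto' (f := fun d : ℕ => ENNReal.log d) (x := atTop) ?_ key)
  rw [← ENNReal.log_top]
  exact (ENNReal.continuous_log.tendsto _).comp ENNReal.tendsto_nat_nhds_top

theorem htop_neg_comp_neg_le (T : ℝ → ℝ) : htop (fun x => -T (-x)) ≤ htop T := by
  have hrange : range (fun x => -T (-x)) = Neg.neg '' range T := by
    rw [← range_comp]
    exact ((Equiv.neg ℝ).surjective.range_comp fun x => -T x)
  rw [htop, hrange, show closure (Neg.neg '' range T) = Neg.neg '' closure (range T) from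
    ((Homeomorph.neg ℝ).image_closure (range T)).symm]
  refine coverEntropy_image_le_of_uniformContinuous ?_ uniformContinuous_neg _
  intro x
  simp

theorem htop_neg_mul_of_even {f : ℝ → ℝ} (hf : ∀ x, f (-x) = f x) (lam : ℝ) :
    htop (fun x => -lam * f x) = htop (fun x => lam * f x) := by
  refine le_antisymm ?_ ?_
  · simpa [hf] using htop_neg_comp_neg_le fun x => lam * f x
  · simpa [hf] using htop_neg_comp_neg_le fun x => -lam * f x

theorem htop_mul_eq_of_even {f : ℝ → ℝ} (hf : ∀ x, f (-x) = f x) {t : EReal}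
    (h : ∀ lam : ℝ, 0 < lam → htop (fun x => lam * f x) = t) {lam : ℝ} (hlam : lam ≠ 0) :
    htop (fun x => lam * f x) = t := by
  rcases lt_or_gt_of_ne hlam with h' | h'
  · rw [← htop_neg_mul_of_even hf]
    exact h _ (neg_pos.2 h')
  · exact h _ h'

theorem exists_function_with_prescribed_entropy (t : EReal) (ht : 0 ≤ t) :
    ∃ f : ℝ →ᵇ ℝ, ∀ lam : ℝ, lam ≠ 0 →
      htop (fun x : ℝ => lam * f x) = t := by
  induction t with
  | bot => simp at ht
  | coe t =>
    have ht0 : 0 ≤ t := EReal.coe_nonneg.1 ht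
    set s : NNReal := ⟨Real.exp t, (Real.exp_pos t).le⟩
    have hs1 : 1 ≤ s := Real.one_le_exp ht0
    have hlog : ENNReal.log s = t := by
      rw [← ENNReal.ofReal_coe_nnreal, ENNReal.log_ofReal_of_pos (show (0 : ℝ) < s from Real.exp_pos t)]
      exact congrArg _ (Real.log_exp t)
    refine ⟨BoundedContinuousFunction.ofNormedAddCommGroup (expZigzag s) (continuous_expZigzag s)
      (Real.exp s) fun x => ?_, fun lam hlam => ?_⟩
    · rw [expZigzag, Real.norm_eq_abs, Real.abs_exp, Real.exp_le_exp]
      exact mul_le_of_le_one_right s.coe_nonneg (zigzag_le _).1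
    · refine htop_mul_eq_of_even (f := expZigzag s) (fun x => ?_)
        (fun lam h => (htop_mul_expZigzag hs1 h).trans hlog) hlam
      rw [expZigzag, Real.log_neg_eq_log, expZigzag]
  | top =>
    refine ⟨BoundedContinuousFunction.ofNormedAddCommGroup wave continuous_wave 1
      fun x => (abs_wave_le x).trans (min_le_left _ _), fun lam hlam => ?_⟩
    exact htop_mul_eq_of_even (f := wave) (fun x => by rw [wave, abs_neg, wave])
      (fun lam h => htop_mul_wave h) hlam
end
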